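/- arXiv:2508.12847 — 3 statements merged into one kernel-verified Lean document; each statement's English description precedes it below -/
import Mathlib

section
/- Corollary 1 (tightness under perfect parity): Let (S,X,T) be jointly distributed random variables with values in finite sets. (a) If S is a deterministic function of T (H(S|T)=0) and H(X|S) ≤ r < H(X), then there exists a probability space carrying (S',X',T',Y) with (S',X',T') distributed as (S,X,T), I(Y;S')=0, I(X';Y) ≤ r, and I(Y;T') = H(T|S); moreover every such Y with I(Y;S')=0 satisfies I(Y;T') ≤ H(T|S). (b) If S is a deterministic function of X (H(S|X)=0), X is a deterministic function of T (H(X|T)=0), and 0 ≤ r ≤ H(X|S), then there exists such a Y with I(Y;S')=0, I(X';Y) ≤ r, and I(Y;T') = H(T|X) + r; moreover every Y with I(X';Y) ≤ r satisfies I(Y;T') ≤ H(T|X) + r. -/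
open MeasureTheory ProbabilityTheory

/-- Shannon entropy (base 2) of a random variable with values in a finite type,
with the convention `0 · log₂ 0 = 0`. -/
noncomputable def ent {Ω α : Type*} [MeasurableSpace Ω] [Fintype α]
    (μ : Measure Ω) (X : Ω → α) : ℝ :=
  ∑ a : α, -((μ (X ⁻¹' {a})).toReal * Real.logb 2 ((μ (X ⁻¹' {a})).toReal))

/-- Conditional Shannon entropy `H(X | Y)` (base 2). -/
noncomputable def condEnt {Ω α β : Type*} [MeasurableSpace Ω] [Fintype α] [Fintype β]
    (μ : Measure Ω) (X : Ω → α) (Y : Ω → β) : ℝ :=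
  ent μ (fun ω => (X ω, Y ω)) - ent μ Y

/-- Mutual information `I(X ; Y)` (base 2). -/
noncomputable def mutInf {Ω α β : Type*} [MeasurableSpace Ω] [Fintype α] [Fintype β]
    (μ : Measure Ω) (X : Ω → α) (Y : Ω → β) : ℝ :=
  ent μ X + ent μ Y - ent μ (fun ω => (X ω, Y ω))

/-- Conditional mutual information `I(X ; Y | Z)` (base 2). -/
noncomputable def condMutInf {Ω α β γ : Type*} [MeasurableSpace Ω] [Fintype α] [Fintype β]
    [Fintype γ] (μ : Measure Ω) (X : Ω → α) (Y : Ω → β) (Z : Ω → γ) : ℝ :=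
  ent μ (fun ω => (X ω, Z ω)) + ent μ (fun ω => (Y ω, Z ω))
    - ent μ (fun ω => (X ω, Y ω, Z ω)) - ent μ Z


/-- The function `-x log₂ x`. -/
noncomputable def hh (x : ℝ) : ℝ := -(x * Real.logb 2 x)

lemma hh_sum_eq_aux {ι : Type*} [Fintype ι] (a : ι → ℝ) :
    hh (∑ i, a i) = ∑ i, -(a i * Real.logb 2 (∑ j, a j)) := by
  simp only [hh, Finset.sum_neg_distrib, Finset.sum_mul]

lemma hh_term_le {ι : Type*} [Fintype ι] (a : ι → ℝ) (h : ∀ i, 0 ≤ a i) (i : ι) :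
    -(a i * Real.logb 2 (∑ j, a j)) ≤ hh (a i) := by
  rcases (h i).eq_or_lt with h0 | h0
  · simp [hh, ← h0]
  · have hle : a i ≤ ∑ j, a j := Finset.single_le_sum (fun j _ => h j) (Finset.mem_univ i)
    have := Real.logb_le_logb_of_le (b := 2) (by norm_num) h0 hle
    unfold hh
    nlinarith

lemma hh_sum_le {ι : Type*} [Fintype ι] (a : ι → ℝ) (h : ∀ i, 0 ≤ a i) :
    hh (∑ i, a i) ≤ ∑ i, hh (a i) := by
  rw [hh_sum_eq_aux]
  exact Finset.sum_le_sum fun i _ => hh_term_le a h i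

lemma hh_sum_eq {ι : Type*} [Fintype ι] (a : ι → ℝ)
    (h : ∀ i, a i = 0 ∨ a i = ∑ j, a j) :
    hh (∑ i, a i) = ∑ i, hh (a i) := by
  rw [hh_sum_eq_aux]
  refine Finset.sum_congr rfl fun i _ => ?_
  rcases h i with h0 | h0
  · simp [hh, h0]
  · rw [hh, ← h0]

lemma hh_sum_eq_imp {ι : Type*} [Fintype ι] (a : ι → ℝ) (h : ∀ i, 0 ≤ a i)
    (he : ∑ i, hh (a i) = hh (∑ i, a i)) (i : ι) : a i = 0 ∨ a i = ∑ j, a j := by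
  rw [hh_sum_eq_aux] at he
  have := (Finset.sum_eq_sum_iff_of_le (fun i _ => hh_term_le a h i)).1 he.symm i
    (Finset.mem_univ i)
  by_cases h0 : a i = 0
  · exact Or.inl h0
  right
  have hpos : 0 < a i := lt_of_le_of_ne (h i) (Ne.symm h0)
  have hle : a i ≤ ∑ j, a j := Finset.single_le_sum (fun j _ => h j) (Finset.mem_univ i)
  have h2 : Real.logb 2 (∑ j, a j) = Real.logb 2 (a i) := by
    unfold hh at this
    exact mul_left_cancel₀ h0 (neg_injective this)
  exact (Real.logb_injOn_pos (by norm_num : (1:ℝ) < 2) (Set.mem_Ioi.2 (hpos.trans_le hle))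
    (Set.mem_Ioi.2 hpos) h2).symm

lemma hh_submod {α β : Type*} [Fintype α] [Fintype β] (p : α → β → ℝ)
    (h : ∀ a b, 0 ≤ p a b) :
    ∑ a, ∑ b, hh (p a b) + hh (∑ a, ∑ b, p a b) ≤
      ∑ a, hh (∑ b, p a b) + ∑ b, hh (∑ a, p a b) := by
  set M := ∑ a, ∑ b, p a b with hM
  set u : α → ℝ := fun a => ∑ b, p a b with hu
  set v : β → ℝ := fun b => ∑ a, p a b with hv
  have e1 : hh M = ∑ a, ∑ b, -(p a b * Real.logb 2 M) := by
    simp only [hh, Finset.sum_neg_distrib, ← Finset.sum_mul]; rfl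
  have e2 : ∑ a, hh (u a) = ∑ a, ∑ b, -(p a b * Real.logb 2 (u a)) := by
    simp only [hh, Finset.sum_neg_distrib, ← Finset.sum_mul]; rfl
  have e3 : ∑ b, hh (v b) = ∑ a, ∑ b, -(p a b * Real.logb 2 (v b)) := by
    rw [Finset.sum_comm]
    simp only [hh, Finset.sum_neg_distrib, ← Finset.sum_mul]; rfl
  change _ ≤ ∑ a, hh (u a) + ∑ b, hh (v b)
  have hu0 : ∀ a, 0 ≤ u a := fun a => Finset.sum_nonneg fun b _ => h a b
  have hv0 : ∀ b, 0 ≤ v b := fun b => Finset.sum_nonneg fun a _ => h a b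
  have hsu : ∑ a, u a = M := rfl
  have hsv : ∑ b, v b = M := by rw [hM, Finset.sum_comm]
  have hM0 : 0 ≤ M := hsu ▸ Finset.sum_nonneg fun a _ => hu0 a
  have key : ∀ a b, hh (p a b) + -(p a b * Real.logb 2 M) ≤
      -(p a b * Real.logb 2 (u a)) + -(p a b * Real.logb 2 (v b)) +
        (u a * v b / M - p a b) / Real.log 2 := by
    intro a b
    have hl : 0 < Real.log 2 := Real.log_pos (by norm_num)
    rcases (h a b).eq_or_lt with h0 | h0
    · rw [← h0]
      have : 0 ≤ u a * v b / M := div_nonneg (mul_nonneg (hu0 a) (hv0 b)) hM0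
      have : 0 ≤ u a * v b / M / Real.log 2 := div_nonneg this hl.le
      simpa [hh] using this
    · have hua : 0 < u a := h0.trans_le
        (Finset.single_le_sum (fun b _ => h a b) (Finset.mem_univ b))
      have hvb : 0 < v b := h0.trans_le
        (Finset.single_le_sum (f := fun a => p a b) (fun a _ => h a b) (Finset.mem_univ a))
      have hMp : 0 < M := hua.trans_le
        (Finset.single_le_sum (fun a _ => hu0 a) (Finset.mem_univ a))
      have hlog := Real.log_le_sub_one_of_pos (x := u a * v b / M / p a b) (by positivity)
      rw [Real.log_div (by positivity) (by positivity), Real.log_div (by positivity)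
        (by positivity), Real.log_mul (by positivity) (by positivity)] at hlog
      have h3 := mul_le_mul_of_nonneg_left hlog h0.le
      have h4 : p a b * (u a * v b / M / p a b - 1) = u a * v b / M - p a b := by
        field_simp
      rw [h4] at h3
      have h5 := div_le_div_of_nonneg_right h3 hl.le
      simp only [hh, Real.logb]
      have h6 : p a b * (Real.log (u a) + Real.log (v b) - Real.log M - Real.log (p a b))
          / Real.log 2 = p a b * (Real.log (u a) / Real.log 2) +
          p a b * (Real.log (v b) / Real.log 2) - p a b * (Real.log M / Real.log 2)
          - p a b * (Real.log (p a b) / Real.log 2) := by ring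
      linarith
  have hsum := Finset.sum_le_sum fun a (_ : a ∈ Finset.univ) =>
    Finset.sum_le_sum fun b (_ : b ∈ Finset.univ) => key a b
  simp only [Finset.sum_add_distrib] at hsum
  have hz : ∑ a, ∑ b, (u a * v b / M - p a b) / Real.log 2 = 0 := by
    simp only [← Finset.sum_div, Finset.sum_sub_distrib, ← Finset.mul_sum, ← Finset.sum_mul]
    rw [hsv, hsu]
    by_cases hMz : M = 0
    · simp [hMz]
    · field_simp; simp
  rw [e1, e2, e3]
  linarith

section entropy
variable {Ω α β γ : Type*} [MeasurableSpace Ω]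

lemma ent_eq [Fintype α] (μ : Measure Ω) (X : Ω → α) :
    ent μ X = ∑ a, hh (μ.real (X ⁻¹' {a})) := rfl

lemma real_part [Fintype α] [MeasurableSpace α] [MeasurableSingletonClass α]
    (μ : Measure Ω) [IsFiniteMeasure μ] {S : Ω → α} (hS : Measurable S) (E : Set Ω) :
    μ.real E = ∑ s, μ.real (E ∩ S ⁻¹' {s}) := by
  have h := sum_measure_preimage_singleton (μ := μ.restrict E) (f := S) Finset.univ
    (fun y _ => hS (measurableSet_singleton y))
  simp only [Finset.coe_univ, Set.preimage_univ, Measure.restrict_apply_univ] at h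
  rw [measureReal_def, ← h, ENNReal.toReal_sum (fun a _ => measure_ne_top _ _)]
  refine Finset.sum_congr rfl fun s _ => ?_
  rw [Measure.restrict_apply (hS (measurableSet_singleton s)), Set.inter_comm]
  rfl

lemma ent_pair [Fintype α] [Fintype β] (μ : Measure Ω) (X : Ω → α) (Y : Ω → β) :
    ent μ (fun ω => (X ω, Y ω)) = ∑ a, ∑ b, hh (μ.real (X ⁻¹' {a} ∩ Y ⁻¹' {b})) := by
  rw [ent_eq, Fintype.sum_prod_type]
  refine Finset.sum_congr rfl fun a _ => Finset.sum_congr rfl fun b _ => ?_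
  congr 2
  ext ω
  simp [Prod.ext_iff]

lemma ent_comp_inj [Fintype α] [Fintype β] (μ : Measure Ω) (X : Ω → α) (g : α → β)
    (hg : Function.Injective g) : ent μ (fun ω => g (X ω)) = ent μ X := by
  rw [ent_eq, ent_eq]
  symm
  refine Fintype.sum_of_injective g hg _ _ ?_ ?_
  · intro b hb
    have : (fun ω => g (X ω)) ⁻¹' {b} = ∅ := by
      ext ω
      simp only [Set.mem_preimage, Set.mem_singleton_iff, Set.mem_empty_iff_false, iff_false]
      exact fun h => hb ⟨_, h⟩
    simp [this, hh]
  · intro a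
    congr 2
    ext ω
    simp [hg.eq_iff]

lemma ent_swap [Fintype α] [Fintype β] (μ : Measure Ω) (X : Ω → α) (Y : Ω → β) :
    ent μ (fun ω => (X ω, Y ω)) = ent μ (fun ω => (Y ω, X ω)) :=
  ent_comp_inj μ (fun ω => (Y ω, X ω)) Prod.swap Prod.swap_injective

lemma ent_le_pair [Fintype α] [Fintype β] [MeasurableSpace β] [MeasurableSingletonClass β]
    (μ : Measure Ω) [IsFiniteMeasure μ] (X : Ω → α) {Y : Ω → β} (hY : Measurable Y) :
    ent μ X ≤ ent μ (fun ω => (X ω, Y ω)) := by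
  rw [ent_pair, ent_eq]
  refine Finset.sum_le_sum fun a _ => ?_
  rw [real_part μ hY]
  exact hh_sum_le _ fun b => measureReal_nonneg

lemma ent_comp_le [Fintype α] [Fintype β] [MeasurableSpace α] [MeasurableSingletonClass α]
    (μ : Measure Ω) [IsFiniteMeasure μ] {X : Ω → α} (hX : Measurable X) (f : α → β) :
    ent μ (fun ω => f (X ω)) ≤ ent μ X := by
  refine (ent_le_pair μ _ hX).trans_eq ?_
  exact ent_comp_inj μ X (fun a => (f a, a)) fun a b h => (Prod.ext_iff.1 h).2

lemma det_of_condEnt [Fintype α] [MeasurableSpace α] [MeasurableSingletonClass α]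
    [Fintype β] (μ : Measure Ω) [IsFiniteMeasure μ] {S : Ω → α} (hS : Measurable S)
    (T : Ω → β) (h : condEnt μ S T = 0) (s : α) (t : β) :
    μ.real (T ⁻¹' {t} ∩ S ⁻¹' {s}) = 0 ∨
      μ.real (T ⁻¹' {t} ∩ S ⁻¹' {s}) = μ.real (T ⁻¹' {t}) := by
  unfold condEnt at h
  rw [ent_swap, ent_pair, ent_eq, sub_eq_zero] at h
  have hle : ∀ t ∈ Finset.univ, hh (μ.real (T ⁻¹' {t})) ≤
      ∑ b, hh (μ.real (T ⁻¹' {t} ∩ S ⁻¹' {b})) := by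
    intro t _
    rw [real_part μ hS (T ⁻¹' {t})]
    exact hh_sum_le _ fun b => measureReal_nonneg
  have h2 := (Finset.sum_eq_sum_iff_of_le hle).1 h.symm t (Finset.mem_univ t)
  rw [real_part μ hS (T ⁻¹' {t})] at h2 ⊢
  exact hh_sum_eq_imp (fun b => μ.real (T ⁻¹' {t} ∩ S ⁻¹' {b})) (fun b => measureReal_nonneg)
    h2.symm s

lemma ent_le_of_det [Fintype α] [MeasurableSpace α] [MeasurableSingletonClass α]
    [Fintype β] [MeasurableSpace β] [MeasurableSingletonClass β] [Fintype γ]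
    (μ : Measure Ω) [IsFiniteMeasure μ] {S : Ω → α} (hS : Measurable S)
    {T : Ω → β} (hT : Measurable T) (h : condEnt μ S T = 0) (Y : Ω → γ) :
    ent μ (fun ω => (Y ω, S ω)) ≤ ent μ (fun ω => (Y ω, T ω)) := by
  refine (ent_le_pair μ _ hT).trans_eq ?_
  have : ent μ (fun ω => ((Y ω, S ω), T ω)) = ent μ (fun ω => ((Y ω, T ω), S ω)) :=
    ent_comp_inj μ (fun ω => ((Y ω, T ω), S ω)) (fun x => ((x.1.1, x.2), x.1.2))
      (by rintro ⟨⟨a, b⟩, c⟩ ⟨⟨a', b'⟩, c'⟩ h; simp_all)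
  rw [this, ent_pair, ent_eq]
  refine Finset.sum_congr rfl fun yt _ => ?_
  rw [real_part μ hS ((fun ω => (Y ω, T ω)) ⁻¹' {yt})]
  refine (hh_sum_eq _ fun s => ?_).symm
  rw [← real_part μ hS ((fun ω => (Y ω, T ω)) ⁻¹' {yt})]
  have hsub : (fun ω => (Y ω, T ω)) ⁻¹' {yt} ⊆ T ⁻¹' {yt.2} := by
    rintro ω rfl; simp
  rcases det_of_condEnt μ hS T h s yt.2 with h0 | h0
  · left
    refine le_antisymm ?_ measureReal_nonneg
    rw [← h0]
    exact measureReal_mono (Set.inter_subset_inter_left _ hsub)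
  · right
    refine le_antisymm (measureReal_mono Set.inter_subset_left) ?_
    have hd : μ.real (T ⁻¹' {yt.2} \ S ⁻¹' {s}) = 0 := by
      have := measureReal_inter_add_sdiff (μ := μ) (s := T ⁻¹' {yt.2})
        (hS (measurableSet_singleton s))
      linarith
    have h1 := measureReal_inter_add_sdiff (μ := μ) (s := (fun ω => (Y ω, T ω)) ⁻¹' {yt})
        (hS (measurableSet_singleton s))
    have h2 : μ.real ((fun ω => (Y ω, T ω)) ⁻¹' {yt} \ S ⁻¹' {s}) ≤ 0 := by
      rw [← hd]
      exact measureReal_mono (Set.sdiff_subset_sdiff_left hsub)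
    linarith

lemma ent_submod [Fintype α] [MeasurableSpace α] [MeasurableSingletonClass α]
    [Fintype β] [MeasurableSpace β] [MeasurableSingletonClass β] [Fintype γ]
    (μ : Measure Ω) [IsFiniteMeasure μ] {A : Ω → α} (hA : Measurable A)
    {B : Ω → β} (hB : Measurable B) (C : Ω → γ) :
    ent μ (fun ω => (C ω, A ω, B ω)) + ent μ C ≤
      ent μ (fun ω => (C ω, A ω)) + ent μ (fun ω => (C ω, B ω)) := by
  rw [ent_pair, ent_pair, ent_pair, ent_eq, ← Finset.sum_add_distrib, ← Finset.sum_add_distrib]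
  refine Finset.sum_le_sum fun c _ => ?_
  rw [Fintype.sum_prod_type]
  have hs : ∀ a b, C ⁻¹' {c} ∩ (fun ω => (A ω, B ω)) ⁻¹' {(a, b)} =
      C ⁻¹' {c} ∩ A ⁻¹' {a} ∩ B ⁻¹' {b} := by
    intro a b; ext ω; simp [and_assoc]
  simp only [hs]
  have := hh_submod (fun a b => μ.real (C ⁻¹' {c} ∩ A ⁻¹' {a} ∩ B ⁻¹' {b}))
    (fun a b => measureReal_nonneg)
  simp only [← real_part μ hB, ← real_part μ hA] at this
  have e : ∀ b, ∑ a, μ.real (C ⁻¹' {c} ∩ A ⁻¹' {a} ∩ B ⁻¹' {b}) =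
      μ.real (C ⁻¹' {c} ∩ B ⁻¹' {b}) := by
    intro b
    rw [real_part μ hA (C ⁻¹' {c} ∩ B ⁻¹' {b})]
    simp only [Set.inter_right_comm]
  simp only [e] at this
  exact this

lemma ent_indep [Fintype α] [MeasurableSpace α] [MeasurableSingletonClass α]
    [Fintype β] [MeasurableSpace β] [MeasurableSingletonClass β]
    (μ : Measure Ω) [IsProbabilityMeasure μ] {A : Ω → α} (hA : Measurable A)
    {B : Ω → β} (hB : Measurable B)
    (h : ∀ a b, μ.real (A ⁻¹' {a} ∩ B ⁻¹' {b}) = μ.real (A ⁻¹' {a}) * μ.real (B ⁻¹' {b})) :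
    ent μ (fun ω => (A ω, B ω)) = ent μ A + ent μ B := by
  have sA : ∑ a, μ.real (A ⁻¹' {a}) = 1 := by
    have := real_part μ hA Set.univ
    simpa using this.symm
  have sB : ∑ a, μ.real (B ⁻¹' {a}) = 1 := by
    have := real_part μ hB Set.univ
    simpa using this.symm
  have hmul : ∀ x y : ℝ, hh (x * y) = y * hh x + x * hh y := by
    intro x y
    unfold hh
    by_cases hx : x = 0
    · simp [hx]
    by_cases hy : y = 0
    · simp [hy]
    rw [Real.logb_mul hx hy]; ring
  rw [ent_pair, ent_eq, ent_eq]
  simp only [h, hmul, Finset.sum_add_distrib, ← Finset.mul_sum, ← Finset.sum_mul, sA, sB, one_mul]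

end entropy

lemma ent_identDistrib {Ω Ω' α β : Type*} [MeasurableSpace Ω] [MeasurableSpace Ω']
    [Fintype α] [MeasurableSpace α] [MeasurableSingletonClass α] [Fintype β]
    {μ : Measure Ω} {μ' : Measure Ω'} {X : Ω → α} {X' : Ω' → α}
    (h : IdentDistrib X X' μ μ') (f : α → β) :
    ent μ' (fun ω => f (X' ω)) = ent μ (fun ω => f (X ω)) := by
  rw [ent_eq, ent_eq]
  refine Finset.sum_congr rfl fun b _ => ?_
  have := h.measure_preimage_eq (s := f ⁻¹' {b}) (Set.toFinite _).measurableSet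
  congr 1
  exact congrArg ENNReal.toReal this.symm

lemma mutInf_comm {Ω α β : Type*} [MeasurableSpace Ω] [Fintype α] [Fintype β]
    (μ : Measure Ω) (X : Ω → α) (Y : Ω → β) : mutInf μ X Y = mutInf μ Y X := by
  unfold mutInf
  rw [ent_swap μ X Y]; ring

/-- Functional representation: `(Z', Q')` has the law of `(Z, Q)`, `Y` is independent of `Z'`
and `Q'` is a function of `(Y, Z')`. -/
lemma func_rep {Ω α β : Type} [MeasurableSpace Ω] (μ : Measure Ω) [IsProbabilityMeasure μ]
    [Fintype α] [MeasurableSpace α] [MeasurableSingletonClass α]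
    [Fintype β] [MeasurableSpace β] [MeasurableSingletonClass β]
    {Z : Ω → α} {Q : Ω → β} (hZ : Measurable Z) (hQ : Measurable Q) :
    ∃ (Ω' : Type) (_ : MeasurableSpace Ω') (μ' : Measure Ω')
      (𝒴 : Type) (_ : Fintype 𝒴) (_ : MeasurableSpace 𝒴) (_ : MeasurableSingletonClass 𝒴)
      (Z' : Ω' → α) (Q' : Ω' → β) (Y : Ω' → 𝒴) (g : 𝒴 × α → β),
      IsProbabilityMeasure μ' ∧ Measurable Z' ∧ Measurable Q' ∧ Measurable Y ∧
      IdentDistrib (fun ω => (Z ω, Q ω)) (fun ω => (Z' ω, Q' ω)) μ μ' ∧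
      ent μ' (fun ω => (Y ω, Z' ω)) = ent μ' Y + ent μ' Z' ∧
      ∀ ω, Q' ω = g (Y ω, Z' ω) := by
  classical
  let ν : α → Measure β := fun a =>
    if μ (Z ⁻¹' {a}) = 0 then μ.map Q else (μ[|Z ⁻¹' {a}]).map Q
  have hν : ∀ a, IsProbabilityMeasure (ν a) := by
    intro a
    by_cases h : μ (Z ⁻¹' {a}) = 0
    · simp only [ν, h, if_true]
      exact Measure.isProbabilityMeasure_map hQ.aemeasurable
    · simp only [ν, h, if_false]
      have := cond_isProbabilityMeasure h
      exact Measure.isProbabilityMeasure_map hQ.aemeasurable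
  have hP1 : IsProbabilityMeasure (μ.map Z) := Measure.isProbabilityMeasure_map hZ.aemeasurable
  have hQ' : Measurable (fun ω : α × (α → β) => ω.2 ω.1) := Measurable.of_discrete
  refine ⟨α × (α → β), inferInstance, (μ.map Z).prod (Measure.pi ν), α → β, inferInstance,
    inferInstance, inferInstance, Prod.fst, fun ω => ω.2 ω.1, Prod.snd, fun x => x.1 x.2,
    inferInstance, measurable_fst, hQ', measurable_snd, ?_, ?_, fun ω => rfl⟩
  · refine ⟨(hZ.prodMk hQ).aemeasurable, (measurable_fst.prodMk hQ').aemeasurable, ?_⟩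
    refine Measure.ext_of_singleton ?_
    rintro ⟨a, b⟩
    rw [Measure.map_apply (hZ.prodMk hQ) (measurableSet_singleton _),
      Measure.map_apply (measurable_fst.prodMk hQ') (measurableSet_singleton _)]
    have e1 : (fun ω : α × (α → β) => (ω.1, ω.2 ω.1)) ⁻¹' {(a, b)} =
        {a} ×ˢ ((fun w : α → β => w a) ⁻¹' {b}) := by
      ext ⟨x, w⟩
      simp only [Set.mem_preimage, Set.mem_singleton_iff, Prod.mk.injEq, Set.mem_prod]
      constructor
      · rintro ⟨rfl, h⟩; exact ⟨rfl, h⟩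
      · rintro ⟨rfl, h⟩; exact ⟨rfl, h⟩
    have e2 : (fun ω => (Z ω, Q ω)) ⁻¹' {(a, b)} = Z ⁻¹' {a} ∩ Q ⁻¹' {b} := by
      ext ω; simp
    have e3 : Measure.pi ν ((fun w : α → β => w a) ⁻¹' {b}) = ν a {b} :=
      (measurePreserving_eval ν a).measure_preimage (measurableSet_singleton b).nullMeasurableSet
    rw [e1, e2, Measure.prod_prod, Measure.map_apply hZ (measurableSet_singleton _), e3]
    by_cases h : μ (Z ⁻¹' {a}) = 0
    · rw [h, zero_mul]
      exact measure_mono_null Set.inter_subset_left h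
    · simp only [ν, h, if_false]
      rw [Measure.map_apply hQ (measurableSet_singleton _),
        cond_apply (hZ (measurableSet_singleton _)), ← mul_assoc,
        ENNReal.mul_inv_cancel h (measure_ne_top _ _), one_mul]
  · refine ent_indep _ measurable_snd measurable_fst fun y z => ?_
    have e1 : (Prod.snd ⁻¹' {y} ∩ Prod.fst ⁻¹' {z} : Set (α × (α → β))) = {z} ×ˢ {y} := by
      ext ⟨x, w⟩; simp [and_comm]
    have e2 : (Prod.snd ⁻¹' {y} : Set (α × (α → β))) = Set.univ ×ˢ {y} := by
      ext ⟨x, w⟩; simp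
    have e3 : (Prod.fst ⁻¹' {z} : Set (α × (α → β))) = {z} ×ˢ Set.univ := by
      ext ⟨x, w⟩; simp
    rw [e1, e2, e3]
    simp only [measureReal_def, Measure.prod_prod, measure_univ, one_mul, mul_one,
      ENNReal.toReal_mul]
    ring

/-- Existence of a representation with prescribed informations. -/
def InfoRep {Ω 𝒮 𝒳 𝒯 : Type} [MeasurableSpace Ω] (μ : Measure Ω)
    [Fintype 𝒮] [MeasurableSpace 𝒮] [Fintype 𝒳] [MeasurableSpace 𝒳]
    [Fintype 𝒯] [MeasurableSpace 𝒯]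
    (S : Ω → 𝒮) (X : Ω → 𝒳) (T : Ω → 𝒯) (i j k : ℝ) : Prop :=
  ∃ (Ω' : Type) (_ : MeasurableSpace Ω') (μ' : Measure Ω')
    (𝒴 : Type) (_ : Fintype 𝒴) (_ : MeasurableSpace 𝒴) (_ : MeasurableSingletonClass 𝒴)
    (S' : Ω' → 𝒮) (X' : Ω' → 𝒳) (T' : Ω' → 𝒯) (Y : Ω' → 𝒴),
    IsProbabilityMeasure μ' ∧
    Measurable S' ∧ Measurable X' ∧ Measurable T' ∧ Measurable Y ∧
    IdentDistrib (fun ω => (S ω, X ω, T ω)) (fun ω => (S' ω, X' ω, T' ω)) μ μ' ∧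
    mutInf μ' Y S' = i ∧ mutInf μ' X' Y = j ∧ mutInf μ' Y T' = k

section reps
variable {Ω 𝒮 𝒳 𝒯 : Type} [MeasurableSpace Ω] (μ : Measure Ω) [IsProbabilityMeasure μ]
    [Fintype 𝒮] [MeasurableSpace 𝒮] [MeasurableSingletonClass 𝒮]
    [Fintype 𝒳] [MeasurableSpace 𝒳] [MeasurableSingletonClass 𝒳]
    [Fintype 𝒯] [MeasurableSpace 𝒯] [MeasurableSingletonClass 𝒯]
    {S : Ω → 𝒮} {X : Ω → 𝒳} {T : Ω → 𝒯}

/-- If `Y` is independent of `S`, `T` is a function of `(Y, S)` and `H(S|T) = 0`. -/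
lemma mutInf_eq_of_rep {𝒴 : Type} [Fintype 𝒴] [MeasurableSpace 𝒴] [MeasurableSingletonClass 𝒴]
    {Y : Ω → 𝒴} (hS : Measurable S) (hT : Measurable T) (hY : Measurable Y)
    (hi : ent μ (fun ω => (Y ω, S ω)) = ent μ Y + ent μ S) (g : 𝒴 × 𝒮 → 𝒯)
    (hg : ∀ ω, T ω = g (Y ω, S ω)) (hc : condEnt μ S T = 0) :
    mutInf μ Y T = condEnt μ T S := by
  have h1 := ent_le_of_det μ hS hT hc Y
  have h2 : ent μ (fun ω => (Y ω, T ω)) ≤ ent μ (fun ω => (Y ω, S ω)) := by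
    have := ent_comp_le μ (hY.prodMk hS) (fun x => (x.1, g x))
    simpa only [← hg] using this
  unfold condEnt at hc ⊢
  unfold mutInf
  rw [ent_swap μ S T] at hc
  linarith

lemma rep_S (hS : Measurable S) (hX : Measurable X) (hT : Measurable T)
    (hc : condEnt μ S T = 0) :
    ∃ j ≤ condEnt μ X S, InfoRep μ S X T 0 j (condEnt μ T S) := by
  obtain ⟨Ω', m, μ', 𝒴, f, m2, m3, S', Q', Y, g, hp, hS', hQ', hY, hid, hi, hg⟩ :=
    func_rep μ hS (hX.prodMk hT)
  have hX' : Measurable (fun ω => (Q' ω).1) := measurable_fst.comp hQ'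
  have hT' : Measurable (fun ω => (Q' ω).2) := measurable_snd.comp hQ'
  have c1 : condEnt μ' S' (fun ω => (Q' ω).2) = condEnt μ S T := by
    unfold condEnt
    rw [ent_identDistrib hid (fun x => (x.1, x.2.2)), ent_identDistrib hid (fun x => x.2.2)]
  have c2 : condEnt μ' (fun ω => (Q' ω).2) S' = condEnt μ T S := by
    unfold condEnt
    rw [ent_identDistrib hid (fun x => (x.2.2, x.1)), ent_identDistrib hid (fun x => x.1)]
  have c3 : condEnt μ' (fun ω => (Q' ω).1) S' = condEnt μ X S := by
    unfold condEnt
    rw [ent_identDistrib hid (fun x => (x.2.1, x.1)), ent_identDistrib hid (fun x => x.1)]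
  refine ⟨mutInf μ' (fun ω => (Q' ω).1) Y, ?_, Ω', m, μ', 𝒴, f, m2, m3, S',
    fun ω => (Q' ω).1, fun ω => (Q' ω).2, Y, hp, hS', hX', hT', hY, hid, ?_, rfl, ?_⟩
  · rw [← c3]
    unfold mutInf condEnt
    have h1 := ent_submod μ' hY hS' (fun ω => (Q' ω).1)
    have h2 := ent_le_pair μ' (fun ω => (Y ω, S' ω)) hX'
    rw [ent_swap μ' (fun ω => (Y ω, S' ω))] at h2
    rw [ent_swap μ' (fun ω => (Q' ω).1) S'] at h1
    rw [ent_swap μ' (fun ω => (Q' ω).1) S']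
    linarith
  · unfold mutInf; linarith
  · rw [← c2]
    exact mutInf_eq_of_rep μ' hS' hT' hY hi (fun x => (g x).2) (fun ω => by rw [hg ω])
      (c1.trans hc)

lemma rep_X (hS : Measurable S) (hX : Measurable X) (hT : Measurable T)
    (hc : condEnt μ S X = 0) (hc' : condEnt μ X T = 0) :
    InfoRep μ S X T 0 0 (condEnt μ T X) := by
  obtain ⟨Ω', m, μ', 𝒴, f, m2, m3, X', Q', Y, g, hp, hX', hQ', hY, hid, hi, hg⟩ :=
    func_rep μ hX (hS.prodMk hT)
  have hS' : Measurable (fun ω => (Q' ω).1) := measurable_fst.comp hQ'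
  have hT' : Measurable (fun ω => (Q' ω).2) := measurable_snd.comp hQ'
  have c1 : condEnt μ' X' (fun ω => (Q' ω).2) = condEnt μ X T := by
    unfold condEnt
    rw [ent_identDistrib hid (fun x => (x.1, x.2.2)), ent_identDistrib hid (fun x => x.2.2)]
  have c2 : condEnt μ' (fun ω => (Q' ω).2) X' = condEnt μ T X := by
    unfold condEnt
    rw [ent_identDistrib hid (fun x => (x.2.2, x.1)), ent_identDistrib hid (fun x => x.1)]
  have c3 : condEnt μ' (fun ω => (Q' ω).1) X' = condEnt μ S X := by
    unfold condEnt
    rw [ent_identDistrib hid (fun x => (x.2.1, x.1)), ent_identDistrib hid (fun x => x.1)]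
  refine ⟨Ω', m, μ', 𝒴, f, m2, m3, fun ω => (Q' ω).1, X', fun ω => (Q' ω).2, Y, hp, hS', hX',
    hT', hY, ?_, ?_, ?_, ?_⟩
  · exact hid.comp (u := fun x => (x.2.1, x.1, x.2.2)) Measurable.of_discrete
  · rw [hc] at c3
    unfold condEnt at c3
    unfold mutInf
    have h1 := ent_submod μ' hY hX' (fun ω => (Q' ω).1)
    have h2 := ent_le_pair μ' (fun ω => (Y ω, X' ω)) hS'
    rw [ent_swap μ' (fun ω => (Y ω, X' ω))] at h2
    rw [ent_swap μ' (fun ω => (Q' ω).1) Y] at h1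
    have h3 := ent_submod μ' hY hS' (fun _ => ())
    have u0 : ent μ' (fun _ => ()) = 0 := by
      rw [ent_eq]; simp [hh]
    have u1 : ent μ' (fun ω => ((), Y ω)) = ent μ' Y :=
      ent_comp_inj μ' Y (fun y => ((), y)) fun a b h => (Prod.ext_iff.1 h).2
    have u2 : ent μ' (fun ω => ((), (Q' ω).1)) = ent μ' (fun ω => (Q' ω).1) :=
      ent_comp_inj μ' (fun ω => (Q' ω).1) (fun y => ((), y)) fun a b h => (Prod.ext_iff.1 h).2
    have u3 : ent μ' (fun ω => ((), Y ω, (Q' ω).1)) = ent μ' (fun ω => (Y ω, (Q' ω).1)) :=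
      ent_comp_inj μ' (fun ω => (Y ω, (Q' ω).1)) (fun y => ((), y))
        fun a b h => (Prod.ext_iff.1 h).2
    linarith
  · rw [mutInf_comm]; unfold mutInf; linarith
  · rw [← c2]
    exact mutInf_eq_of_rep μ' hX' hT' hY hi (fun x => (g x).2) (fun ω => by rw [hg ω])
      (c1.trans hc')

end reps

lemma hh_mul (x y : ℝ) : hh (x * y) = y * hh x + x * hh y := by
  unfold hh
  by_cases hx : x = 0
  · simp [hx]
  by_cases hy : y = 0
  · simp [hy]
  rw [Real.logb_mul hx hy]; ring

section mix
variable {Ω₁ Ω₂ : Type} [MeasurableSpace Ω₁] [MeasurableSpace Ω₂]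

/-- Mixture of two measures. -/
noncomputable def mix (μ₁ : Measure Ω₁) (μ₂ : Measure Ω₂) (p : ℝ) : Measure (Ω₁ ⊕ Ω₂) :=
  ENNReal.ofReal p • μ₁.map Sum.inl + ENNReal.ofReal (1 - p) • μ₂.map Sum.inr

variable (μ₁ : Measure Ω₁) (μ₂ : Measure Ω₂) [IsProbabilityMeasure μ₁] [IsProbabilityMeasure μ₂]
  {p : ℝ}

lemma mix_apply (p : ℝ) {E : Set (Ω₁ ⊕ Ω₂)} (hE : MeasurableSet E) :
    mix μ₁ μ₂ p E = ENNReal.ofReal p * μ₁ (Sum.inl ⁻¹' E) +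
      ENNReal.ofReal (1 - p) * μ₂ (Sum.inr ⁻¹' E) := by
  simp [mix, Measure.map_apply measurable_inl hE, Measure.map_apply measurable_inr hE]

lemma mix_prob (h0 : 0 ≤ p) (h1 : p ≤ 1) : IsProbabilityMeasure (mix μ₁ μ₂ p) := by
  constructor
  rw [mix_apply _ _ _ MeasurableSet.univ]
  simp only [Set.preimage_univ, measure_univ, mul_one]
  rw [← ENNReal.ofReal_add h0 (by linarith)]
  simp

lemma mix_real (h0 : 0 ≤ p) (h1 : p ≤ 1) {E : Set (Ω₁ ⊕ Ω₂)} (hE : MeasurableSet E) :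
    (mix μ₁ μ₂ p).real E = p * μ₁.real (Sum.inl ⁻¹' E) + (1 - p) * μ₂.real (Sum.inr ⁻¹' E) := by
  rw [measureReal_def, mix_apply _ _ _ hE, ENNReal.toReal_add (by finiteness) (by finiteness),
    ENNReal.toReal_mul, ENNReal.toReal_mul, ENNReal.toReal_ofReal h0,
    ENNReal.toReal_ofReal (by linarith)]
  rfl

lemma ent_mix {α β : Type} [Fintype α] [MeasurableSpace α] [MeasurableSingletonClass α]
    [Fintype β] [MeasurableSpace β] [MeasurableSingletonClass β]
    (h0 : 0 ≤ p) (h1 : p ≤ 1) {A : Ω₁ → α} {B : Ω₂ → β} (hA : Measurable A) (hB : Measurable B) :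
    ent (mix μ₁ μ₂ p) (Sum.map A B) =
      hh p + hh (1 - p) + p * ent μ₁ A + (1 - p) * ent μ₂ B := by
  have sA : ∑ a, μ₁.real (A ⁻¹' {a}) = 1 := by
    have := real_part μ₁ hA Set.univ
    simpa using this.symm
  have sB : ∑ a, μ₂.real (B ⁻¹' {a}) = 1 := by
    have := real_part μ₂ hB Set.univ
    simpa using this.symm
  have hM : ∀ E : Set (α ⊕ β), MeasurableSet (Sum.map A B ⁻¹' E) := by
    intro E
    refine measurableSet_sum_iff.2 ⟨?_, ?_⟩
    · exact hA (Set.toFinite (Sum.inl ⁻¹' E)).measurableSet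
    · exact hB (Set.toFinite (Sum.inr ⁻¹' E)).measurableSet
  have eA : ∀ a, (mix μ₁ μ₂ p).real (Sum.map A B ⁻¹' {Sum.inl a}) = p * μ₁.real (A ⁻¹' {a}) := by
    intro a
    rw [mix_real _ _ h0 h1 (hM _)]
    have e1 : Sum.inl ⁻¹' (Sum.map A B ⁻¹' {Sum.inl a}) = A ⁻¹' {a} := by ext; simp
    have e2 : Sum.inr ⁻¹' (Sum.map A B ⁻¹' {Sum.inl a}) = ∅ := by ext; simp
    rw [e1, e2]; simp
  have eB : ∀ b, (mix μ₁ μ₂ p).real (Sum.map A B ⁻¹' {Sum.inr b}) =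
      (1 - p) * μ₂.real (B ⁻¹' {b}) := by
    intro b
    rw [mix_real _ _ h0 h1 (hM _)]
    have e1 : Sum.inl ⁻¹' (Sum.map A B ⁻¹' {Sum.inr b}) = ∅ := by ext; simp
    have e2 : Sum.inr ⁻¹' (Sum.map A B ⁻¹' {Sum.inr b}) = B ⁻¹' {b} := by ext; simp
    rw [e1, e2]; simp
  rw [ent_eq, Fintype.sum_sum_type]
  simp only [eA, eB, hh_mul, Finset.sum_add_distrib, ← Finset.mul_sum, ← Finset.sum_mul, sA, sB]
  rw [← ent_eq, ← ent_eq]; ring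

lemma mutInf_mix {α β ζ : Type} [Fintype α] [MeasurableSpace α] [MeasurableSingletonClass α]
    [Fintype β] [MeasurableSpace β] [MeasurableSingletonClass β]
    [Fintype ζ] [MeasurableSpace ζ] [MeasurableSingletonClass ζ]
    (h0 : 0 ≤ p) (h1 : p ≤ 1) {A : Ω₁ → α} {B : Ω₂ → β} (hA : Measurable A) (hB : Measurable B)
    {Z₁ : Ω₁ → ζ} {Z₂ : Ω₂ → ζ} (hZ₁ : Measurable Z₁) (hZ₂ : Measurable Z₂)
    (e1 : ent μ₁ Z₁ = ent (mix μ₁ μ₂ p) (Sum.elim Z₁ Z₂))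
    (e2 : ent μ₂ Z₂ = ent (mix μ₁ μ₂ p) (Sum.elim Z₁ Z₂)) :
    mutInf (mix μ₁ μ₂ p) (Sum.map A B) (Sum.elim Z₁ Z₂) =
      p * mutInf μ₁ A Z₁ + (1 - p) * mutInf μ₂ B Z₂ := by
  have h := ent_comp_inj (mix μ₁ μ₂ p)
    (Sum.map (fun ω => (A ω, Z₁ ω)) (fun ω => (B ω, Z₂ ω)))
    (Equiv.sumProdDistrib α β ζ).symm (Equiv.injective _)
  have hf : (fun ω => (Equiv.sumProdDistrib α β ζ).symm
      (Sum.map (fun ω => (A ω, Z₁ ω)) (fun ω => (B ω, Z₂ ω)) ω)) =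
      fun ω => (Sum.map A B ω, Sum.elim Z₁ Z₂ ω) := by
    funext ω
    cases ω <;> rfl
  rw [hf, ent_mix _ _ h0 h1 (hA.prodMk hZ₁) (hB.prodMk hZ₂)] at h
  unfold mutInf
  rw [h, ent_mix _ _ h0 h1 hA hB, e1, e2]
  ring

end mix

lemma InfoRep.mix {Ω 𝒮 𝒳 𝒯 : Type} [MeasurableSpace Ω] {μ : Measure Ω}
    [Fintype 𝒮] [MeasurableSpace 𝒮] [MeasurableSingletonClass 𝒮]
    [Fintype 𝒳] [MeasurableSpace 𝒳] [MeasurableSingletonClass 𝒳]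
    [Fintype 𝒯] [MeasurableSpace 𝒯] [MeasurableSingletonClass 𝒯]
    {S : Ω → 𝒮} {X : Ω → 𝒳} {T : Ω → 𝒯} {i j k i' j' k' p : ℝ}
    (R : InfoRep μ S X T i j k) (R' : InfoRep μ S X T i' j' k') (h0 : 0 ≤ p) (h1 : p ≤ 1) :
    InfoRep μ S X T (p * i + (1 - p) * i') (p * j + (1 - p) * j') (p * k + (1 - p) * k') := by
  obtain ⟨Ω₁, _, μ₁, 𝒴₁, _, _, _, S₁, X₁, T₁, Y₁, _, hS₁, hX₁, hT₁, hY₁, id₁, rfl, rfl, rfl⟩ := R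
  obtain ⟨Ω₂, _, μ₂, 𝒴₂, _, _, _, S₂, X₂, T₂, Y₂, _, hS₂, hX₂, hT₂, hY₂, id₂, rfl, rfl, rfl⟩ := R'
  have hS := hS₁.sumElim hS₂
  have hX := hX₁.sumElim hX₂
  have hT := hT₁.sumElim hT₂
  have hid : IdentDistrib (fun ω => (S ω, X ω, T ω))
      (fun ω => (Sum.elim S₁ S₂ ω, Sum.elim X₁ X₂ ω, Sum.elim T₁ T₂ ω)) μ (_root_.mix μ₁ μ₂ p) := by
    refine ⟨id₁.aemeasurable_fst, (hS.prodMk (hX.prodMk hT)).aemeasurable, ?_⟩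
    refine Measure.ext fun E hE => ?_
    rw [Measure.map_apply (hS.prodMk (hX.prodMk hT)) hE,
      mix_apply _ _ _ ((hS.prodMk (hX.prodMk hT)) hE), Measure.map_apply_of_aemeasurable
        id₁.aemeasurable_fst hE]
    have a1 := id₁.measure_preimage_eq hE
    have a2 := id₂.measure_preimage_eq hE
    have b1 : Sum.inl ⁻¹' ((fun ω => (Sum.elim S₁ S₂ ω, Sum.elim X₁ X₂ ω, Sum.elim T₁ T₂ ω)) ⁻¹' E)
      = (fun ω => (S₁ ω, X₁ ω, T₁ ω)) ⁻¹' E := rfl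
    have b2 : Sum.inr ⁻¹' ((fun ω => (Sum.elim S₁ S₂ ω, Sum.elim X₁ X₂ ω, Sum.elim T₁ T₂ ω)) ⁻¹' E)
      = (fun ω => (S₂ ω, X₂ ω, T₂ ω)) ⁻¹' E := rfl
    rw [b1, b2, ← a1, ← a2, ← add_mul, ← ENNReal.ofReal_add h0 (by linarith)]
    simp
  refine ⟨Ω₁ ⊕ Ω₂, inferInstance, _root_.mix μ₁ μ₂ p, 𝒴₁ ⊕ 𝒴₂, inferInstance, ⊤,
    @MeasurableSingletonClass.mk _ ⊤ fun _ => trivial, Sum.elim S₁ S₂,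
    Sum.elim X₁ X₂, Sum.elim T₁ T₂, Sum.map Y₁ Y₂, mix_prob _ _ h0 h1, hS, hX, hT, ?_, hid,
    ?_, ?_, ?_⟩
  · intro E _
    refine measurableSet_sum_iff.2 ⟨?_, ?_⟩
    · exact hY₁ (Set.toFinite (Sum.inl ⁻¹' E)).measurableSet
    · exact hY₂ (Set.toFinite (Sum.inr ⁻¹' E)).measurableSet
  · exact mutInf_mix μ₁ μ₂ h0 h1 hY₁ hY₂ hS₁ hS₂
      ((ent_identDistrib id₁ (fun x => x.1)).trans (ent_identDistrib hid (fun x => x.1)).symm)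
      ((ent_identDistrib id₂ (fun x => x.1)).trans (ent_identDistrib hid (fun x => x.1)).symm)
  · rw [mutInf_comm, mutInf_comm μ₁, mutInf_comm μ₂]
    exact mutInf_mix μ₁ μ₂ h0 h1 hY₁ hY₂ hX₁ hX₂
      ((ent_identDistrib id₁ (fun x => x.2.1)).trans (ent_identDistrib hid (fun x => x.2.1)).symm)
      ((ent_identDistrib id₂ (fun x => x.2.1)).trans (ent_identDistrib hid (fun x => x.2.1)).symm)
  · exact mutInf_mix μ₁ μ₂ h0 h1 hY₁ hY₂ hT₁ hT₂
      ((ent_identDistrib id₁ (fun x => x.2.2)).trans (ent_identDistrib hid (fun x => x.2.2)).symm)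
      ((ent_identDistrib id₂ (fun x => x.2.2)).trans (ent_identDistrib hid (fun x => x.2.2)).symm)

/-- **Corollary 1 (tightness under perfect parity).**
(a) If `S` is a deterministic function of `T` (`H(S|T) = 0`) and `H(X|S) ≤ r < H(X)`,
then there is a representation `Y` with `I(Y;S') = 0`, `I(X';Y) ≤ r`, and
`I(Y;T') = H(T|S)`; moreover every representation `Y` with `I(Y;S') = 0` satisfies
`I(Y;T') ≤ H(T|S)`.
(b) If `S` is a deterministic function of `X` (`H(S|X) = 0`), `X` is a deterministic
function of `T` (`H(X|T) = 0`), and `0 ≤ r ≤ H(X|S)`, then there is a representation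
`Y` with `I(Y;S') = 0`, `I(X';Y) ≤ r`, and `I(Y;T') = H(T|X) + r`; moreover every
representation `Y` with `I(X';Y) ≤ r` satisfies `I(Y;T') ≤ H(T|X) + r`. -/
theorem corollary_tightness_perfect_parity
    {Ω 𝒮 𝒳 𝒯 : Type} [MeasurableSpace Ω] (μ : Measure Ω) [IsProbabilityMeasure μ]
    [Fintype 𝒮] [MeasurableSpace 𝒮] [MeasurableSingletonClass 𝒮]
    [Fintype 𝒳] [MeasurableSpace 𝒳] [MeasurableSingletonClass 𝒳]
    [Fintype 𝒯] [MeasurableSpace 𝒯] [MeasurableSingletonClass 𝒯]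
    (S : Ω → 𝒮) (X : Ω → 𝒳) (T : Ω → 𝒯)
    (hS : Measurable S) (hX : Measurable X) (hT : Measurable T)
    (r : ℝ) :
    -- part (a)
    ((condEnt μ S T = 0 ∧ condEnt μ X S ≤ r ∧ r < ent μ X) →
      ((∃ (Ω' : Type) (_ : MeasurableSpace Ω') (μ' : Measure Ω')
          (𝒴 : Type) (_ : Fintype 𝒴) (_ : MeasurableSpace 𝒴)
          (S' : Ω' → 𝒮) (X' : Ω' → 𝒳) (T' : Ω' → 𝒯) (Y : Ω' → 𝒴),
          IsProbabilityMeasure μ' ∧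
          Measurable S' ∧ Measurable X' ∧ Measurable T' ∧ Measurable Y ∧
          IdentDistrib (fun ω => (S ω, X ω, T ω)) (fun ω => (S' ω, X' ω, T' ω)) μ μ' ∧
          mutInf μ' Y S' = 0 ∧ mutInf μ' X' Y ≤ r ∧
          mutInf μ' Y T' = condEnt μ T S) ∧
        (∀ (Ω' : Type) (_ : MeasurableSpace Ω') (μ' : Measure Ω')
          (𝒴 : Type) (_ : Fintype 𝒴) (_ : MeasurableSpace 𝒴)
          (S' : Ω' → 𝒮) (X' : Ω' → 𝒳) (T' : Ω' → 𝒯) (Y : Ω' → 𝒴),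
          IsProbabilityMeasure μ' →
          Measurable S' → Measurable X' → Measurable T' → Measurable Y →
          IdentDistrib (fun ω => (S ω, X ω, T ω)) (fun ω => (S' ω, X' ω, T' ω)) μ μ' →
          mutInf μ' Y S' = 0 →
          mutInf μ' Y T' ≤ condEnt μ T S))) ∧
    -- part (b)
    ((condEnt μ S X = 0 ∧ condEnt μ X T = 0 ∧ 0 ≤ r ∧ r ≤ condEnt μ X S) →
      ((∃ (Ω' : Type) (_ : MeasurableSpace Ω') (μ' : Measure Ω')
          (𝒴 : Type) (_ : Fintype 𝒴) (_ : MeasurableSpace 𝒴)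
          (S' : Ω' → 𝒮) (X' : Ω' → 𝒳) (T' : Ω' → 𝒯) (Y : Ω' → 𝒴),
          IsProbabilityMeasure μ' ∧
          Measurable S' ∧ Measurable X' ∧ Measurable T' ∧ Measurable Y ∧
          IdentDistrib (fun ω => (S ω, X ω, T ω)) (fun ω => (S' ω, X' ω, T' ω)) μ μ' ∧
          mutInf μ' Y S' = 0 ∧ mutInf μ' X' Y ≤ r ∧
          mutInf μ' Y T' = condEnt μ T X + r) ∧
        (∀ (Ω' : Type) (_ : MeasurableSpace Ω') (μ' : Measure Ω')
          (𝒴 : Type) (_ : Fintype 𝒴) (_ : MeasurableSpace 𝒴)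
          (S' : Ω' → 𝒮) (X' : Ω' → 𝒳) (T' : Ω' → 𝒯) (Y : Ω' → 𝒴),
          IsProbabilityMeasure μ' →
          Measurable S' → Measurable X' → Measurable T' → Measurable Y →
          IdentDistrib (fun ω => (S ω, X ω, T ω)) (fun ω => (S' ω, X' ω, T' ω)) μ μ' →
          mutInf μ' X' Y ≤ r →
          mutInf μ' Y T' ≤ condEnt μ T X + r))) := by
  constructor
  · rintro ⟨hc, hr, -⟩
    constructor
    · obtain ⟨j, hj, Ω', m, μ', 𝒴, f, m2, m3, S', X', T', Y, hp, hS', hX', hT', hY, hid, h1, h2,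
        h3⟩ := rep_S μ hS hX hT hc
      exact ⟨Ω', m, μ', 𝒴, f, m2, S', X', T', Y, hp, hS', hX', hT', hY, hid, h1,
        h2.le.trans (hj.trans hr), h3⟩
    · intro Ω' m μ' 𝒴 f m2 S' X' T' Y hp hS' hX' hT' hY hid h1
      have c1 : condEnt μ' S' T' = condEnt μ S T := by
        unfold condEnt
        rw [ent_identDistrib hid (fun x => (x.1, x.2.2)), ent_identDistrib hid (fun x => x.2.2)]
      have c2 : condEnt μ' T' S' = condEnt μ T S := by
        unfold condEnt
        rw [ent_identDistrib hid (fun x => (x.2.2, x.1)), ent_identDistrib hid (fun x => x.1)]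
      rw [hc] at c1
      have h2 := ent_le_of_det μ' hS' hT' c1 Y
      rw [← c2]
      unfold condEnt at c1 ⊢
      unfold mutInf at h1 ⊢
      rw [ent_swap μ' S' T'] at c1
      linarith
  · rintro ⟨hc, hc', h0, hr⟩
    have hST : condEnt μ S T = 0 := by
      have h1 := ent_le_of_det μ hS hX hc T
      have h2 := ent_le_pair μ T hS
      unfold condEnt at hc' ⊢
      rw [ent_swap μ X T] at hc'
      rw [ent_swap μ S T]
      linarith
    constructor
    · obtain ⟨j, hj, R⟩ := rep_S μ hS hX hT hST
      have R' := rep_X μ hS hX hT hc hc'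
      have hpr : r / condEnt μ X S * condEnt μ X S = r := by
        by_cases hz : condEnt μ X S = 0
        · rw [hz] at hr ⊢; simp; linarith
        · exact div_mul_cancel₀ _ hz
      have hp0 : 0 ≤ r / condEnt μ X S := div_nonneg h0 (h0.trans hr)
      have hp1 : r / condEnt μ X S ≤ 1 := div_le_one_of_le₀ hr (h0.trans hr)
      set p := r / condEnt μ X S with hp
      obtain ⟨Ω', m, μ', 𝒴, f, m2, m3, S', X', T', Y, hp, hS', hX', hT', hY, hid, h1, h2, h3⟩ :=
        R.mix R' hp0 hp1
      refine ⟨Ω', m, μ', 𝒴, f, m2, S', X', T', Y, hp, hS', hX', hT', hY, hid, ?_, ?_, ?_⟩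
      · rw [h1]; ring
      · rw [h2]
        have := mul_le_mul_of_nonneg_left hj hp0
        linarith
      · rw [h3]
        have : condEnt μ T S = condEnt μ T X + condEnt μ X S := by
          unfold condEnt at hc hc' hST ⊢
          rw [ent_swap μ T S, ent_swap μ T X, ent_swap μ X S]
          linarith
        rw [this]
        linear_combination hpr
    · intro Ω' m μ' 𝒴 f m2 S' X' T' Y hp hS' hX' hT' hY hid h1
      have c1 : condEnt μ' X' T' = condEnt μ X T := by
        unfold condEnt
        rw [ent_identDistrib hid (fun x => (x.2.1, x.2.2)), ent_identDistrib hid (fun x => x.2.2)]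
      have c2 : condEnt μ' T' X' = condEnt μ T X := by
        unfold condEnt
        rw [ent_identDistrib hid (fun x => (x.2.2, x.2.1)), ent_identDistrib hid (fun x => x.2.1)]
      rw [hc'] at c1
      have h2 := ent_le_of_det μ' hX' hT' c1 Y
      rw [← c2]
      unfold condEnt at c1 ⊢
      unfold mutInf at h1 ⊢
      rw [ent_swap μ' X' T'] at c1
      rw [ent_swap μ' X' Y] at h1
      linarith
end

section
/- Lower bound L₂^{r,ε} of Theorem 2: Let (S,X,T) be jointly distributed random variables with values in finite sets, let ε satisfy 0 ≤ ε < min{I(S;X), H(S)}, let r satisfy 0 ≤ r ≤ H(X|S) + ε, and set α = r/(H(X|S)+ε). Then there exists a probability space carrying random variables (S',X',T',Y) such that (S',X',T') has the same joint distribution as (S,X,T), Y takes values in a finite set, I(Y;S') ≤ ε, I(X';Y) ≤ r, and I(Y;T') ≥ H(T|(X,S)) + r − α·H((X,S)|T) − 1.06 − log₂((1−α)·I((X,S);T) + α·min{H(T), H(X,S)} + 5.51). -/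
open MeasureTheory ProbabilityTheory

lemma race_lintegral {τ : Type} [Fintype τ] [DecidableEq τ] (m : τ → Measure ℝ) [∀ t, IsProbabilityMeasure (m t)]
    (t : τ) (c : τ → ℝ) (φ : ℝ → ENNReal) (hφ : Measurable φ) :
    ∫⁻ e in {e : τ → ℝ | ∀ t', t' ≠ t → c t' * e t < e t'}, φ (e t) ∂(Measure.pi m)
      = ∫⁻ x, φ x * ∏ t' : {t' : τ // ¬ t' = t}, m t' (Set.Ioi (c t' * x)) ∂(m t) := by
  set A := {e : τ → ℝ | ∀ t', t' ≠ t → c t' * e t < e t'} with hA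
  have hAm : MeasurableSet A := by
    rw [hA]
    have : {e : τ → ℝ | ∀ t', t' ≠ t → c t' * e t < e t'}
        = ⋂ t', ⋂ (_ : t' ≠ t), {e : τ → ℝ | c t' * e t < e t'} := by
      ext e; simp
    rw [this]
    refine MeasurableSet.iInter fun t' => MeasurableSet.iInter fun _ => ?_
    exact measurableSet_lt (by fun_prop) (by fun_prop)
  have h1 := measurePreserving_piEquivPiSubtypeProd (α := fun _ : τ => ℝ) m (fun t' => t' = t)
  rw [← lintegral_indicator hAm]
  have h2 : (fun e => A.indicator (fun e => φ (e t)) e)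
      = (fun p : ({t' : τ // t' = t} → ℝ) × ({t' : τ // ¬ t' = t} → ℝ) =>
          (φ (p.1 ⟨t, rfl⟩)) * (Set.univ.pi (fun t' : {t' : τ // ¬ t' = t} => Set.Ioi (c t' * p.1 ⟨t, rfl⟩))).indicator 1 p.2) ∘
        (MeasurableEquiv.piEquivPiSubtypeProd (fun _ : τ => ℝ) (fun t' => t' = t)) := by
    funext e
    classical
    simp only [Function.comp, Set.indicator_apply, Set.mem_pi, Set.mem_univ, hA, Set.mem_ofPred_eq,
      MeasurableEquiv.piEquivPiSubtypeProd, Equiv.piEquivPiSubtypeProd, MeasurableEquiv.coe_mk, Equiv.coe_fn_mk]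
    simp
  have hm : Measurable (fun p : ({t' : τ // t' = t} → ℝ) × ({t' : τ // ¬ t' = t} → ℝ) =>
          (φ (p.1 ⟨t, rfl⟩)) * (Set.univ.pi (fun t' : {t' : τ // ¬ t' = t} => Set.Ioi (c t' * p.1 ⟨t, rfl⟩))).indicator 1 p.2) := by
    refine Measurable.mul (by fun_prop) ?_
    have : (fun p : ({t' : τ // t' = t} → ℝ) × ({t' : τ // ¬ t' = t} → ℝ) => (Set.univ.pi (fun t' : {t' : τ // ¬ t' = t} => Set.Ioi (c t' * p.1 ⟨t, rfl⟩))).indicator (1 : ({t' : τ // ¬ t' = t} → ℝ) → ENNReal) p.2)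
      = Set.indicator {p | ∀ t' : {t' : τ // ¬ t' = t}, c t' * p.1 ⟨t, rfl⟩ < p.2 t'} 1 := by
      funext p
      classical
      simp [Set.indicator_apply]
    rw [this]
    refine measurable_one.indicator ?_
    rw [Set.ofPred_forall]
    exact MeasurableSet.iInter fun t' => measurableSet_lt (by fun_prop) (by fun_prop)
  rw [h2]
  refine (h1.lintegral_comp hm).trans ?_
  rw [lintegral_prod _ hm.aemeasurable]
  have h3 : ∀ x : {t' : τ // t' = t} → ℝ, ∫⁻ y, (φ (x ⟨t, rfl⟩)) * (Set.univ.pi (fun t' : {t' : τ // ¬ t' = t} => Set.Ioi (c t' * x ⟨t, rfl⟩))).indicator 1 y ∂(Measure.pi fun i : {t' : τ // ¬ t' = t} => m i) = φ (x ⟨t, rfl⟩) * ∏ t' : {t' : τ // ¬ t' = t}, m t' (Set.Ioi (c t' * x ⟨t, rfl⟩)) := by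
    intro x
    have hs : MeasurableSet (Set.univ.pi (fun t' : {t' : τ // ¬ t' = t} => Set.Ioi (c t' * x ⟨t, rfl⟩))) :=
      MeasurableSet.univ_pi fun _ => measurableSet_Ioi
    rw [lintegral_const_mul _ (measurable_one.indicator hs), lintegral_indicator_one hs, Measure.pi_pi]
  simp_rw [h3]
  have h4 := measurePreserving_eval (fun i : {t' : τ // t' = t} => m i) ⟨t, rfl⟩
  have h5 : Measurable (fun x => φ x * ∏ t' : {t' : τ // ¬ t' = t}, m t' (Set.Ioi (c t' * x))) := by
    refine hφ.mul (Finset.measurable_prod _ fun t' _ => ?_)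
    have : Measurable (Function.uncurry fun (x y : ℝ) => (Set.Ioi (c t' * x)).indicator (1 : ℝ → ENNReal) y) := by
      have : (Function.uncurry fun (x y : ℝ) => (Set.Ioi (c t' * x)).indicator (1 : ℝ → ENNReal) y)
        = Set.indicator {p : ℝ × ℝ | c t' * p.1 < p.2} 1 := by
        funext p; simp [Set.indicator_apply, Function.uncurry]
      rw [this]
      exact measurable_one.indicator (measurableSet_lt (by fun_prop) (by fun_prop))
    have := Measurable.lintegral_prod_right (ν := m t') this
    simpa only [lintegral_indicator_one measurableSet_Ioi] using this
  convert h4.lintegral_comp h5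

lemma exp_Ioi {r : ℝ} (hr : 0 < r) {x : ℝ} (hx : 0 ≤ x) :
    expMeasure r (Set.Ioi x) = ENNReal.ofReal (Real.exp (-(r * x))) := by
  have := isProbabilityMeasure_expMeasure hr
  have h := cdf_expMeasure_eq hr x
  rw [if_pos hx, cdf_eq_real] at h
  have h2 : (expMeasure r).real (Set.Ioi x) = Real.exp (-(r*x)) := by
    rw [← Set.compl_Iic, measureReal_compl measurableSet_Iic, h]; simp
  rw [← h2, ofReal_measureReal]

lemma exp_lintegral {r : ℝ} (φ : ℝ → ENNReal) (hφ : Measurable φ) :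
    ∫⁻ x, φ x ∂(expMeasure r) = ∫⁻ x in Set.Ioi 0, ENNReal.ofReal (r * Real.exp (-(r*x))) * φ x := by
  have : expMeasure r = volume.withDensity (exponentialPDF r) := rfl
  rw [this, lintegral_withDensity_eq_lintegral_mul _ _ hφ, ← lintegral_indicator measurableSet_Ioi]
  · refine lintegral_congr_ae ?_
    filter_upwards [Measure.ae_ne volume (0:ℝ)] with x hx
    simp only [Pi.mul_apply, exponentialPDF_eq, Set.indicator_apply, Set.mem_Ioi]
    rcases lt_or_gt_of_ne hx with h | h
    · simp [not_le.2 h, not_lt.2 h.le]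
    · simp [h, h.le]
  · exact (measurable_exponentialPDFReal r).ennreal_ofReal

lemma exp_mean {r : ℝ} (hr : 0 < r) : 
    ∫⁻ x, ENNReal.ofReal x ∂(expMeasure r) = ENNReal.ofReal (1 / r) := by
  rw [exp_lintegral _ (by fun_prop)]
  have h := Real.integral_rpow_mul_exp_neg_mul_Ioi (a := 2) (r := r) (by norm_num) hr
  norm_num at h
  have h0 : ∫ x in Set.Ioi (0:ℝ), r * (x * Real.exp (-(r*x))) = 1 / r := by
    rw [integral_const_mul, h]; field_simp
  rw [← h0, ofReal_integral_eq_lintegral_ofReal]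
  · refine setLIntegral_congr_fun measurableSet_Ioi fun x hx => ?_
    rw [← ENNReal.ofReal_mul (by positivity)]; congr 1; ring
  · refine Integrable.const_mul ?_ _
    by_contra hc
    rw [integral_undef hc] at h
    exact absurd h.symm (by positivity)
  · filter_upwards [ae_restrict_mem measurableSet_Ioi] with x hx
    have : (0:ℝ) < x := hx
    positivity

lemma race_exp {τ : Type} [Fintype τ] [DecidableEq τ] (l k : τ → ℝ) (hl : ∀ t, 0 < l t)
    (hk : ∀ t, 0 ≤ k t) (hk1 : ∑ t, k t = 1) (t : τ) (ht : 0 < k t)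
    (φ : ℝ → ENNReal) (hφ : Measurable φ) :
    ∫⁻ e in {e : τ → ℝ | ∀ t', t' ≠ t → (k t' / l t') / (k t / l t) * e t < e t'}, φ (e t)
        ∂(Measure.pi fun t => expMeasure (l t))
      = ENNReal.ofReal (k t) * ∫⁻ x, φ x ∂(expMeasure (l t / k t)) := by
  have hP : ∀ t, IsProbabilityMeasure (expMeasure (l t)) := fun t =>
    isProbabilityMeasure_expMeasure (hl t)
  rw [race_lintegral (fun t => expMeasure (l t)) t (fun t' => (k t' / l t') / (k t / l t)) φ hφ]
  have h0 : ∀ x ∈ Set.Ioi (0:ℝ), ∏ t' : {t' : τ // ¬ t' = t}, expMeasure (l t') (Set.Ioi ((k t' / l t') / (k t / l t) * x))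
      = ENNReal.ofReal (Real.exp (-((1 - k t) * (l t / k t) * x))) := by
    intro x hx
    have hx : 0 < x := hx
    have h1 : ∀ t' : {t' : τ // ¬ t' = t}, expMeasure (l t') (Set.Ioi ((k t' / l t') / (k t / l t) * x))
        = ENNReal.ofReal (Real.exp (-(k t' * ((l t / k t) * x)))) := by
      intro t'
      have := hl t'
      have := hk t'
      have := hl t
      rw [exp_Ioi (hl t') (by positivity)]
      congr 3
      field_simp
    rw [Finset.prod_congr rfl fun t' _ => h1 t', ← ENNReal.ofReal_prod_of_nonneg (fun _ _ => (Real.exp_pos _).le),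
      ← Real.exp_sum, Finset.sum_neg_distrib, ← Finset.sum_mul]
    congr 3
    have h2 : ∑ t' : {t' : τ // ¬ t' = t}, k t' = 1 - k t := by
      rw [← hk1, ← Fintype.sum_subtype_add_sum_subtype (fun t' => t' = t) k]
      have : ∀ inst : Fintype {t' : τ // t' = t}, ∑ t' : {t' : τ // t' = t}, k t' = k t := by
        intro inst
        rw [Fintype.sum_unique]; rfl
      rw [this]; ring
    rw [h2]; ring
  have h5 : Measurable (fun x => φ x * ∏ t' : {t' : τ // ¬ t' = t}, expMeasure (l t') (Set.Ioi ((k t' / l t') / (k t / l t) * x))) := by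
    refine hφ.mul (Finset.measurable_prod _ fun t' _ => ?_)
    have : Measurable (Function.uncurry fun (x y : ℝ) => (Set.Ioi ((k t' / l t') / (k t / l t) * x)).indicator (1 : ℝ → ENNReal) y) := by
      have : (Function.uncurry fun (x y : ℝ) => (Set.Ioi ((k t' / l t') / (k t / l t) * x)).indicator (1 : ℝ → ENNReal) y)
        = Set.indicator {p : ℝ × ℝ | (k t' / l t') / (k t / l t) * p.1 < p.2} 1 := by
        funext p; simp [Set.indicator_apply, Function.uncurry]
      rw [this]
      exact measurable_one.indicator (measurableSet_lt (by fun_prop) (by fun_prop))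
    have := Measurable.lintegral_prod_right (ν := expMeasure (l t')) this
    simpa only [lintegral_indicator_one measurableSet_Ioi] using this
  rw [exp_lintegral _ h5, exp_lintegral _ hφ, ← lintegral_const_mul _ (by fun_prop)]
  refine setLIntegral_congr_fun measurableSet_Ioi fun x hx => ?_
  rw [h0 x hx]
  have hlt := hl t
  have : ENNReal.ofReal (l t * Real.exp (-(l t * x))) * ENNReal.ofReal (Real.exp (-((1 - k t) * (l t / k t) * x)))
     = ENNReal.ofReal (k t) * ENNReal.ofReal (l t / k t * Real.exp (-(l t / k t * x))) := by
    rw [← ENNReal.ofReal_mul (by positivity), ← ENNReal.ofReal_mul (by positivity), mul_assoc, ← Real.exp_add]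
    congr 1
    have : -(l t * x) + -((1 - k t) * (l t / k t) * x) = -(l t / k t * x) := by field_simp; ring
    rw [this]; field_simp
  rw [mul_comm (φ x), ← mul_assoc, ← mul_assoc, this]

lemma F_int {s l : ℝ} (hs : 0 < s) (hl : 0 < l) :
    Integrable (fun x : ℝ => (1 + 15 * max x 0) ^ (-(1 + s))) (expMeasure l) ∧
    ∫ x, (1 + 15 * max x 0) ^ (-(1 + s)) ∂(expMeasure l) ≤ l / (15 * s) := by
  have := isProbabilityMeasure_expMeasure hl
  have hm : Measurable (fun x : ℝ => (1 + 15 * max x 0) ^ (-(1 + s))) := by fun_prop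
  have hpos : ∀ x : ℝ, 0 < 1 + 15 * max x 0 := fun x => by
    have := le_max_right x 0; linarith
  have hI : Integrable (fun x : ℝ => (1 + 15 * max x 0) ^ (-(1 + s))) (expMeasure l) := by
    refine Integrable.of_bound hm.aestronglyMeasurable 1 (Filter.Eventually.of_forall fun x => ?_)
    rw [Real.norm_of_nonneg (Real.rpow_nonneg (hpos x).le _)]
    refine Real.rpow_le_one_of_one_le_of_nonpos ?_ (by linarith)
    have := le_max_right x 0; linarith
  refine ⟨hI, ?_⟩
  have hd : ∀ x ∈ Set.Ici (0:ℝ), HasDerivAt (fun x : ℝ => -(1 + 15 * x) ^ (-s) / (15 * s)) ((1 + 15 * x) ^ (-(1 + s))) x := by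
    intro x hx
    have hx : 0 ≤ x := hx
    have h1 : HasDerivAt (fun x : ℝ => 1 + 15 * x) 15 x := by
      simpa using ((hasDerivAt_id x).const_mul 15).const_add 1
    have h2 := (h1.rpow_const (p := -s) (Or.inl (by positivity))).neg.div_const (15 * s)
    refine h2.congr_deriv ?_
    have : -s - 1 = -(1 + s) := by ring
    rw [this]; field_simp
  have ht : Filter.Tendsto (fun x : ℝ => -(1 + 15 * x) ^ (-s) / (15 * s)) Filter.atTop (nhds 0) := by
    have h1 : Filter.Tendsto (fun x : ℝ => 1 + 15 * x) Filter.atTop Filter.atTop :=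
      Filter.tendsto_atTop_add_const_left _ _ (Filter.tendsto_id.const_mul_atTop (by norm_num))
    have h2 := ((tendsto_rpow_neg_atTop hs).comp h1).neg.div_const (15 * s)
    simpa using h2
  have hintg := integrableOn_Ioi_deriv_of_nonneg' hd (fun x hx => by
    have : (0:ℝ) < x := hx
    positivity) ht
  have hval := integral_Ioi_of_hasDerivAt_of_tendsto' hd hintg ht
  rw [integral_eq_lintegral_of_nonneg_ae (Filter.Eventually.of_forall fun x => Real.rpow_nonneg (hpos x).le _) hm.aestronglyMeasurable]
  refine ENNReal.toReal_le_of_le_ofReal (by positivity) ?_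
  rw [exp_lintegral _ (by fun_prop)]
  have : l / (15 * s) = ∫ x in Set.Ioi (0:ℝ), l * (1 + 15 * x) ^ (-(1 + s)) := by
    rw [integral_const_mul, hval]; simp; field_simp
  rw [this, ofReal_integral_eq_lintegral_ofReal (Integrable.const_mul hintg _)]
  · refine setLIntegral_mono' measurableSet_Ioi fun x hx => ?_
    have hx : 0 < x := hx
    rw [max_eq_left hx.le, ← ENNReal.ofReal_mul (by positivity)]
    refine ENNReal.ofReal_le_ofReal ?_
    refine mul_le_mul_of_nonneg_right ?_ (by positivity)
    have : Real.exp (-(l * x)) ≤ 1 := Real.exp_le_one_iff.2 (by have := mul_pos hl hx; linarith)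
    nlinarith
  · filter_upwards [ae_restrict_mem measurableSet_Ioi] with x hx
    have : (0:ℝ) < x := hx
    positivity

lemma exp_ae_nonneg {l : ℝ} (hl : 0 < l) : ∀ᵐ x ∂(expMeasure l), 0 ≤ x := by
  have := isProbabilityMeasure_expMeasure hl
  have h := exp_Ioi hl le_rfl
  have h2 : expMeasure l (Set.Ioi 0)ᶜ = 0 := by
    rw [prob_compl_eq_zero_iff measurableSet_Ioi, h]; simp
  have h3 : ∀ᵐ x ∂(expMeasure l), x ∈ Set.Ioi (0:ℝ) := h2
  filter_upwards [h3] with x hx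
  exact le_of_lt hx

/-- The event that `t` wins the race. -/
def raceSet {τ : Type} (l k : τ → ℝ) (t : τ) : Set (τ → ℝ) :=
  {e | 0 < k t ∧ ∀ t', t' ≠ t → (k t' / l t') / (k t / l t) * e t < e t'}

lemma raceSet_meas {τ : Type} [Fintype τ] (l k : τ → ℝ) (t : τ) : MeasurableSet (raceSet l k t) := by
  have : raceSet l k t
      = {e : τ → ℝ | 0 < k t} ∩ ⋂ t', ⋂ (_ : t' ≠ t), {e : τ → ℝ | (k t' / l t') / (k t / l t) * e t < e t'} := by
    ext e; simp [raceSet]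
  rw [this]
  refine (MeasurableSet.const _).inter (MeasurableSet.iInter fun t' => MeasurableSet.iInter fun _ => ?_)
  exact measurableSet_lt (by fun_prop) (by fun_prop)

lemma raceSet_unique {τ : Type} (l k : τ → ℝ) (hl : ∀ t, 0 < l t) {t t' : τ} {e : τ → ℝ}
    (h : e ∈ raceSet l k t) (h' : e ∈ raceSet l k t') : t = t' := by
  by_contra hne
  obtain ⟨h1, h2⟩ := h
  obtain ⟨h1', h2'⟩ := h'
  have a := h2 t' (Ne.symm hne)
  have b := h2' t hne
  have p1 : 0 < k t / l t := div_pos h1 (hl t)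
  have p2 : 0 < k t' / l t' := div_pos h1' (hl t')
  rw [div_mul_eq_mul_div, div_lt_iff₀ p1] at a
  rw [div_mul_eq_mul_div, div_lt_iff₀ p2] at b
  linarith

lemma raceSet_facts {τ : Type} [Fintype τ] [DecidableEq τ] (l k : τ → ℝ) (hl : ∀ t, 0 < l t)
    (hk : ∀ t, 0 ≤ k t) (hk1 : ∑ t, k t = 1) (t : τ) :
    (Measure.pi fun t => expMeasure (l t)) (raceSet l k t) = ENNReal.ofReal (k t) ∧
    IntegrableOn (fun e : τ → ℝ => e t) (raceSet l k t) (Measure.pi fun t => expMeasure (l t)) ∧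
    ∫ e in raceSet l k t, e t ∂(Measure.pi fun t => expMeasure (l t)) = k t * (k t / l t) := by
  have hP : ∀ t, IsProbabilityMeasure (expMeasure (l t)) := fun t =>
    isProbabilityMeasure_expMeasure (hl t)
  rcases (hk t).eq_or_lt with h0 | h0
  · have : raceSet l k t = ∅ := by
      ext e; simp [raceSet, ← h0]
    rw [this]; simp [← h0]
  · have hset : raceSet l k t = {e | ∀ t', t' ≠ t → (k t' / l t') / (k t / l t) * e t < e t'} := by
      ext e; simp [raceSet, h0]
    have hpos : 0 < l t / k t := div_pos (hl t) h0
    have := isProbabilityMeasure_expMeasure hpos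
    have A := race_exp l k hl hk hk1 t h0 (fun _ => 1) measurable_const
    have B := race_exp l k hl hk hk1 t h0 ENNReal.ofReal (by fun_prop)
    rw [← hset] at A B
    rw [exp_mean hpos] at B
    have hae : ∀ᵐ e ∂((Measure.pi fun t => expMeasure (l t)).restrict (raceSet l k t)), 0 ≤ e t :=
      ae_restrict_of_ae ((measurePreserving_eval (fun t => expMeasure (l t)) t).quasiMeasurePreserving.ae
        (exp_ae_nonneg (hl t)))
    refine ⟨by simpa using A, ?_, ?_⟩
    · refine ⟨(measurable_pi_apply t).aestronglyMeasurable, ?_⟩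
      rw [hasFiniteIntegral_iff_ofReal hae, B]
      exact ENNReal.mul_lt_top ENNReal.ofReal_lt_top ENNReal.ofReal_lt_top
    · rw [integral_eq_lintegral_of_nonneg_ae hae (measurable_pi_apply t).aestronglyMeasurable, B,
        ENNReal.toReal_mul, ENNReal.toReal_ofReal h0.le, ENNReal.toReal_ofReal (by positivity), one_div_div]

/-- Pushforward of a weight function. -/
noncomputable def push {α β : Type} [Fintype α] [DecidableEq β] (p : α → ℝ) (f : α → β) (b : β) : ℝ :=
  ∑ a, if f a = b then p a else 0

/-- Entropy (nats) of the pushforward of a weight function. -/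
noncomputable def HH {α β : Type} [Fintype α] [Fintype β] [DecidableEq β] (p : α → ℝ) (f : α → β) : ℝ :=
  ∑ b, Real.negMulLog (push p f b)

lemma push_nonneg {α β : Type} [Fintype α] [DecidableEq β] {p : α → ℝ} (hp : ∀ a, 0 ≤ p a)
    (f : α → β) (b : β) : 0 ≤ push p f b :=
  Finset.sum_nonneg fun a _ => by split_ifs <;> simp [hp]

lemma push_sum_mul {α β : Type} [Fintype α] [Fintype β] [DecidableEq β] (p : α → ℝ)
    (f : α → β) (φ : β → ℝ) : ∑ b, push p f b * φ b = ∑ a, p a * φ (f a) := by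
  simp only [push, Finset.sum_mul]
  rw [Finset.sum_comm]
  refine Finset.sum_congr rfl fun a _ => ?_
  simp [ite_mul]

lemma push_sum {α β : Type} [Fintype α] [Fintype β] [DecidableEq β] (p : α → ℝ)
    (f : α → β) : ∑ b, push p f b = ∑ a, p a := by
  simpa using push_sum_mul p f (fun _ => 1)

/-- Gibbs inequality, unnormalised. -/
lemma negMulLog_le {r a : ℝ} (hr : 0 ≤ r) (ha : 0 < a) :
    Real.negMulLog r ≤ r * (-Real.log a) + a - r := by
  rcases hr.eq_or_lt with h | h
  · simp [← h, ha.le]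
  · have h1 := Real.log_le_sub_one_of_pos (div_pos ha h)
    rw [Real.log_div ha.ne' h.ne'] at h1
    have h2 := mul_le_mul_of_nonneg_left h1 hr
    have h3 : r * (a / r - 1) = a - r := by field_simp
    rw [h3] at h2
    simp only [Real.negMulLog]; nlinarith

lemma gibbs_code {ω τ : Type} [Fintype ω] [Fintype τ] [DecidableEq τ] (P : ω → ℝ)
    (hP0 : ∀ w, 0 ≤ P w) (hP1 : ∑ w, P w = 1) (f : ω → τ) (B : Finset τ) (hf : ∀ w, f w ∈ B)
    (a : τ → ℝ) (ha : ∀ t, 0 < a t) (c : ℝ) (hc : 0 < c) :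
    HH P f ≤ ∑ w, P w * (-Real.log (a (f w))) + Real.log c + (∑ t ∈ B, a t) / c - 1 := by
  have h1 : HH P f = ∑ t ∈ B, Real.negMulLog (push P f t) := by
    unfold HH
    symm
    refine Finset.sum_subset (Finset.subset_univ _) fun t _ ht => ?_
    have : push P f t = 0 := Finset.sum_eq_zero fun w _ => by
      rw [if_neg]; rintro rfl; exact ht (hf w)
    simp [this]
  have h2 : ∑ t ∈ B, push P f t = 1 := by
    rw [← hP1, ← push_sum P f]
    refine Finset.sum_subset (Finset.subset_univ _) fun t _ ht => ?_
    exact Finset.sum_eq_zero fun w _ => by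
      rw [if_neg]; rintro rfl; exact ht (hf w)
  have h3 : ∑ t ∈ B, push P f t * (-Real.log (a t)) = ∑ w, P w * (-Real.log (a (f w))) := by
    rw [← push_sum_mul P f (fun t => -Real.log (a t))]
    refine Finset.sum_subset (Finset.subset_univ _) fun t _ ht => ?_
    have : push P f t = 0 := Finset.sum_eq_zero fun w _ => by
      rw [if_neg]; rintro rfl; exact ht (hf w)
    simp [this]
  rw [h1]
  calc ∑ t ∈ B, Real.negMulLog (push P f t) 
      ≤ ∑ t ∈ B, (push P f t * (-Real.log (a t)) + push P f t * Real.log c + a t / c - push P f t) := by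
        refine Finset.sum_le_sum fun t _ => ?_
        have := negMulLog_le (push_nonneg hP0 f t) (div_pos (ha t) hc)
        rw [Real.log_div (ha t).ne' hc.ne'] at this
        linarith
    _ = _ := by
        rw [Finset.sum_sub_distrib, Finset.sum_add_distrib, Finset.sum_add_distrib, h2, h3,
          ← Finset.sum_mul, h2, ← Finset.sum_div]
        ring

lemma kl_term {k p : ℝ} (hk : 0 ≤ k) (hp : 0 ≤ p) (h : 0 < k → 0 < p) :
    k - p ≤ k * Real.log (k / p) := by
  rcases hk.eq_or_lt with h0 | h0
  · simp [← h0, hp]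
  · have hp := h h0
    have h1 := Real.one_sub_inv_le_log_of_pos (div_pos h0 hp)
    have := mul_le_mul_of_nonneg_left h1 hk
    have e : k * (1 - (k / p)⁻¹) = k - p := by field_simp
    linarith

lemma jensen_term {k p l : ℝ} (hk : 0 ≤ k) (hp : 0 ≤ p) (h : 0 < k → 0 < p) (hl : 0 < p → l = p) :
    k * Real.log (1 + 15 * (k / l)) ≤ k * Real.log (k / p) + k * Real.log 16 + (p - k) / 16 := by
  rcases hk.eq_or_lt with h0 | h0
  · simp only [← h0]; simp; positivity
  · have hp := h h0
    rw [hl hp]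
    have e1 : 1 + 15 * (k / p) = (k / p) * (16 * ((15 + p / k) / 16)) := by field_simp; ring
    have h1 := Real.log_le_sub_one_of_pos (show 0 < (15 + p / k) / 16 by positivity)
    rw [e1, Real.log_mul (by positivity) (by positivity), Real.log_mul (by positivity) (by positivity)]
    have := mul_le_mul_of_nonneg_left h1 hk
    have e : k * ((15 + p / k) / 16 - 1) = (p - k) / 16 := by field_simp; ring
    nlinarith

lemma tangent {x y : ℝ} (hx : 0 ≤ x) (hy : 0 ≤ y) :
    Real.log (1 + 15 * x) ≤ Real.log (1 + 15 * y) + 15 / (1 + 15 * y) * (x - y) := by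
  have h1 := Real.log_le_sub_one_of_pos (show 0 < (1 + 15 * x) / (1 + 15 * y) by positivity)
  rw [Real.log_div (by positivity) (by positivity)] at h1
  have : (1 + 15 * x) / (1 + 15 * y) - 1 = 15 / (1 + 15 * y) * (x - y) := by field_simp; ring
  linarith

lemma sfrl {ω τ : Type} [Fintype ω] [DecidableEq ω] [Fintype τ] [DecidableEq τ] (P : ω → ℝ)
    (hP0 : ∀ w, 0 ≤ P w) (hP1 : ∑ w, P w = 1) (k : ω → τ → ℝ) (hk0 : ∀ w t, 0 ≤ k w t)
    (hk1 : ∀ w, ∑ t, k w t = 1) (p : τ → ℝ) (hp : ∀ t, p t = ∑ w, P w * k w t)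
    (hsupp : ∀ w t, 0 < k w t → 0 < p t) :
    ∃ Q : (ω → τ) → ℝ, (∀ f, 0 ≤ Q f) ∧ (∑ f, Q f = 1) ∧
      (∀ w t, ∑ f, (if f w = t then Q f else 0) = k w t) ∧
      0 ≤ ∑ w, P w * ∑ t, k w t * Real.log (k w t / p t) ∧
      ∑ f, Q f * HH P f ≤ (∑ w, P w * ∑ t, k w t * Real.log (k w t / p t)) + Real.log 16 + 1
        + Real.log (((∑ w, P w * ∑ t, k w t * Real.log (k w t / p t)) + Real.log 16) / 15) := by
  set I := ∑ w, P w * ∑ t, k w t * Real.log (k w t / p t) with hI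
  set N := I + Real.log 16 with hN
  have hp0 : ∀ t, 0 ≤ p t := fun t => by
    rw [hp]; exact Finset.sum_nonneg fun w _ => mul_nonneg (hP0 w) (hk0 w t)
  have hp1 : ∑ t, p t = 1 := by
    simp_rw [hp]; rw [Finset.sum_comm]; simp_rw [← Finset.mul_sum, hk1, mul_one, hP1]
  have hI0 : 0 ≤ I := by
    refine Finset.sum_nonneg fun w _ => mul_nonneg (hP0 w) ?_
    calc (0:ℝ) = ∑ t, (k w t - p t) := by rw [Finset.sum_sub_distrib, hk1, hp1]; simp
      _ ≤ _ := Finset.sum_le_sum fun t _ => kl_term (hk0 w t) (hp0 t) (hsupp w t)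
  have hNpos : 0 < N := by
    have : 0 < Real.log 16 := Real.log_pos (by norm_num)
    linarith
  obtain ⟨t0, ht0⟩ : ∃ t, 0 < p t := by
    by_contra! hc
    have : ∑ t, p t ≤ 0 := Finset.sum_nonpos fun t _ => hc t
    linarith
  set l : τ → ℝ := fun t => if 0 < p t then p t else 1 with hldef
  have hl : ∀ t, 0 < l t := fun t => by simp only [hldef]; split_ifs <;> linarith
  have hlp : ∀ t, 0 < p t → l t = p t := fun t ht => by simp [hldef, ht]
  have hPM : ∀ t, IsProbabilityMeasure (expMeasure (l t)) := fun t =>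
    isProbabilityMeasure_expMeasure (hl t)
  set ν := Measure.pi fun t => expMeasure (l t) with hν
  have facts := fun w t => raceSet_facts l (k w) hl (hk0 w) (hk1 w) t
  rw [← hν] at facts
  set B : Finset τ := Finset.univ.filter fun t => 0 < p t with hB
  letI : MeasurableSpace τ := ⊤
  have : ∀ w, ∃ g : (τ → ℝ) → τ, Measurable g ∧ (∀ t e, e ∈ raceSet l (k w) t → g e = t) ∧ (∀ e, g e ∈ B)
      ∧ ∀ᵐ e ∂ν, e ∈ raceSet l (k w) (g e) := by
    intro w
    classical
    let g : (τ → ℝ) → τ := fun e => if h : ∃ t, e ∈ raceSet l (k w) t then h.choose else t0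
    have hg : ∀ t e, e ∈ raceSet l (k w) t → g e = t := by
      intro t e he
      have h : ∃ t, e ∈ raceSet l (k w) t := ⟨t, he⟩
      simp only [g, dif_pos h]
      exact raceSet_unique l (k w) hl h.choose_spec he
    have hg0 : ∀ e, (¬ ∃ t, e ∈ raceSet l (k w) t) → g e = t0 := fun e h => by simp only [g, dif_neg h]
    refine ⟨g, ?_, hg, ?_, ?_⟩
    · refine measurable_to_countable' fun t => ?_
      have : g ⁻¹' {t} = raceSet l (k w) t ∪ ({e | t = t0} ∩ (⋃ t, raceSet l (k w) t)ᶜ) := by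
        ext e
        simp only [Set.mem_preimage, Set.mem_singleton_iff, Set.mem_union, Set.mem_inter_iff,
          Set.mem_compl_iff, Set.mem_iUnion, Set.mem_ofPred_eq]
        by_cases h : ∃ t, e ∈ raceSet l (k w) t
        · obtain ⟨t', ht'⟩ := h
          rw [hg t' e ht']
          constructor
          · rintro rfl; exact Or.inl ht'
          · rintro (h | h)
            · exact raceSet_unique l (k w) hl ht' h
            · exact absurd ⟨t', ht'⟩ h.2
        · rw [hg0 e h]
          constructor
          · rintro rfl; exact Or.inr ⟨rfl, h⟩
          · rintro (h' | h')
            · exact absurd ⟨t, h'⟩ h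
            · exact h'.1.symm
      rw [this]
      exact (raceSet_meas _ _ _).union ((MeasurableSet.const _).inter (MeasurableSet.iUnion fun t => raceSet_meas _ _ _).compl)
    · intro e
      by_cases h : ∃ t, e ∈ raceSet l (k w) t
      · obtain ⟨t', ht'⟩ := h
        rw [hg t' e ht']
        simpa [hB] using hsupp w t' ht'.1
      · rw [hg0 e h]; simpa [hB] using ht0
    · have h1 : ν (⋃ t, raceSet l (k w) t) = 1 := by
        rw [measure_iUnion _ fun t => raceSet_meas _ _ _, tsum_fintype, Finset.sum_congr rfl fun t _ => (facts w t).1,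
          ← ENNReal.ofReal_sum_of_nonneg fun t _ => hk0 w t, hk1]
        · simp
        · intro t t' hne
          exact Set.disjoint_left.2 fun e he he' => hne (raceSet_unique l (k w) hl he he')
      have h2 := (prob_compl_eq_zero_iff (MeasurableSet.iUnion fun t => raceSet_meas l (k w) t)).2 h1
      have h3 : ∀ᵐ e ∂ν, e ∈ ⋃ t, raceSet l (k w) t := h2
      filter_upwards [h3] with e he
      obtain ⟨t, ht⟩ := Set.mem_iUnion.1 he
      rwa [hg t e ht]
  choose g hgm hg hgB hgae using this
  set G : (τ → ℝ) → (ω → τ) := fun e w => g w e with hG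
  have hGm : Measurable G := measurable_pi_lambda _ hgm
  have hGP : IsProbabilityMeasure (ν.map G) := Measure.isProbabilityMeasure_map hGm.aemeasurable
  refine ⟨fun f => (ν.map G).real {f}, fun f => measureReal_nonneg, ?_, ?_, hI0, ?_⟩
  · rw [sum_measureReal_singleton]; simp
  · intro w t
    rw [← Finset.sum_filter, sum_measureReal_singleton, map_measureReal_apply hGm (Set.toFinite _).measurableSet]
    have h1 : ν.real (raceSet l (k w) t) = k w t := by
      rw [measureReal_def, (facts w t).1, ENNReal.toReal_ofReal (hk0 w t)]
    rw [← h1]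
    refine measureReal_congr ?_
    filter_upwards [hgae w] with e he
    refine propext ?_
    change (G e ∈ _) ↔ e ∈ raceSet l (k w) t
    simp only [hG, Finset.coe_filter, Finset.mem_univ, true_and, Set.mem_ofPred_eq]
    constructor
    · rintro rfl; exact he
    · intro h; exact hg w t e h
  · have hs : 0 < 1 / N := by positivity
    have e1 : ∑ f, (ν.map G).real {f} * HH P f = ∫ e, HH P (G e) ∂ν := by
      rw [← integral_map (f := fun f => HH P f) hGm.aemeasurable (measurable_of_countable _).aestronglyMeasurable,
        integral_fintype (Integrable.of_finite)]
      simp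
    have hFi := fun t => F_int hs (hl t)
    have hmp := fun t => measurePreserving_eval (fun t => expMeasure (l t)) t
    let T : ω → τ → ℝ → ℝ := fun w t x => Real.log (1 + 15 * (k w t / l t)) + 15 / (1 + 15 * (k w t / l t)) * (x - k w t / l t)
    let U : (τ → ℝ) → ℝ := fun e => ∑ w, P w * ((1 + 1 / N) * ∑ t, (raceSet l (k w) t).indicator (fun e => T w t (e t)) e)
      + Real.log (N / 15) + (∑ t ∈ B, (1 + 15 * max (e t) 0) ^ (-(1 + 1 / N))) / (N / 15) - 1
    have hTi : ∀ w t, IntegrableOn (fun e : τ → ℝ => T w t (e t)) (raceSet l (k w) t) ν := fun w t =>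
      (integrable_const _).add (((facts w t).2.1.sub (integrable_const _)).const_mul _)
    have hTv : ∀ w t, ∫ e in raceSet l (k w) t, T w t (e t) ∂ν = k w t * Real.log (1 + 15 * (k w t / l t)) := by
      intro w t
      have h1 : ν.real (raceSet l (k w) t) = k w t := by
        rw [measureReal_def, (facts w t).1, ENNReal.toReal_ofReal (hk0 w t)]
      simp only [T]
      have hs1 : IntegrableOn (fun e : τ → ℝ => e t - k w t / l t) (raceSet l (k w) t) ν :=
        (facts w t).2.1.sub (integrable_const _)
      have hs2 : IntegrableOn (fun e : τ → ℝ => 15 / (1 + 15 * (k w t / l t)) * (e t - k w t / l t))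
        (raceSet l (k w) t) ν := hs1.const_mul _
      rw [integral_add (integrable_const _) hs2,
        integral_const_mul, integral_sub (facts w t).2.1 (integrable_const _), (facts w t).2.2]
      simp [h1]
    have hi1 : ∀ w, Integrable (fun e => ∑ t, (raceSet l (k w) t).indicator (fun e => T w t (e t)) e) ν := fun w =>
      integrable_finsetSum _ fun t _ => (hTi w t).integrable_indicator (raceSet_meas _ _ _)
    have hi2 : Integrable (fun e => ∑ w, P w * ((1 + 1 / N) * ∑ t, (raceSet l (k w) t).indicator (fun e => T w t (e t)) e)) ν :=
      integrable_finsetSum _ fun w _ => ((hi1 w).const_mul _).const_mul _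
    have hi3 : ∀ t, Integrable (fun e : τ → ℝ => (1 + 15 * max (e t) 0) ^ (-(1 + 1 / N))) ν := fun t =>
      (hmp t).integrable_comp_of_integrable (hFi t).1
    have hi4 : Integrable (fun e : τ → ℝ => (∑ t ∈ B, (1 + 15 * max (e t) 0) ^ (-(1 + 1 / N))) / (N / 15)) ν :=
      (integrable_finsetSum _ fun t _ => hi3 t).div_const _
    have hv1 : ∀ w, ∫ e, ∑ t, (raceSet l (k w) t).indicator (fun e => T w t (e t)) e ∂ν ≤ ∑ t, k w t * Real.log (k w t / p t) + Real.log 16 := by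
      intro w
      rw [integral_finsetSum _ fun t _ => (hTi w t).integrable_indicator (raceSet_meas _ _ _)]
      simp_rw [integral_indicator (raceSet_meas _ _ _), hTv]
      calc _ ≤ ∑ t, (k w t * Real.log (k w t / p t) + k w t * Real.log 16 + (p t - k w t) / 16) :=
            Finset.sum_le_sum fun t _ => jensen_term (hk0 w t) (hp0 t) (hsupp w t) (hlp t)
        _ = _ := by
          rw [Finset.sum_add_distrib, Finset.sum_add_distrib, ← Finset.sum_mul, hk1, ← Finset.sum_div,
            Finset.sum_sub_distrib, hk1, hp1]; ring
    have hv2 : ∫ e, ∑ w, P w * ((1 + 1 / N) * ∑ t, (raceSet l (k w) t).indicator (fun e => T w t (e t)) e) ∂ν ≤ (1 + 1 / N) * N := by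
      rw [integral_finsetSum _ fun w _ => ((hi1 w).const_mul _).const_mul _]
      simp_rw [integral_const_mul]
      calc _ ≤ ∑ w, P w * ((1 + 1 / N) * (∑ t, k w t * Real.log (k w t / p t) + Real.log 16)) :=
            Finset.sum_le_sum fun w _ => mul_le_mul_of_nonneg_left (mul_le_mul_of_nonneg_left (hv1 w) (by positivity)) (hP0 w)
        _ = (1 + 1 / N) * (∑ w, P w * ∑ t, k w t * Real.log (k w t / p t) + (∑ w, P w) * Real.log 16) := by
          rw [Finset.sum_mul, ← Finset.sum_add_distrib, Finset.mul_sum]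
          exact Finset.sum_congr rfl fun w _ => by ring
        _ = _ := by rw [hP1, hN, hI]; ring
    have hv3 : ∫ e : τ → ℝ, (∑ t ∈ B, (1 + 15 * max (e t) 0) ^ (-(1 + 1 / N))) / (N / 15) ∂ν ≤ 1 := by
      rw [integral_div, integral_finsetSum _ fun t _ => hi3 t, div_le_one (by positivity)]
      calc _ ≤ ∑ t ∈ B, l t / (15 * (1 / N)) := Finset.sum_le_sum fun t _ => by
            have h2 : ∫ e : τ → ℝ, (1 + 15 * max (e t) 0) ^ (-(1 + 1 / N)) ∂ν
                = ∫ x, (1 + 15 * max x 0) ^ (-(1 + 1 / N)) ∂(expMeasure (l t)) := by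
              rw [← (hmp t).map_eq, integral_map (measurable_pi_apply t).aemeasurable]
              exact (Measurable.pow_const (by fun_prop) _).aestronglyMeasurable
            exact (le_of_eq h2).trans (hFi t).2
        _ = (∑ t ∈ B, p t) * (N / 15) := by
            rw [Finset.sum_mul]
            refine Finset.sum_congr rfl fun t ht => ?_
            rw [hlp t (by simpa [hB] using ht)]; field_simp
        _ ≤ 1 * (N / 15) := by
            refine mul_le_mul_of_nonneg_right ?_ (by positivity)
            rw [← hp1]
            exact Finset.sum_le_univ_sum_of_nonneg hp0
        _ = _ := one_mul _
    have hle : ∀ᵐ e ∂ν, HH P (G e) ≤ U e := by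
      have hnn : ∀ᵐ e ∂ν, ∀ t, 0 ≤ e t := ae_all_iff.2 fun t =>
        (hmp t).quasiMeasurePreserving.ae (exp_ae_nonneg (hl t))
      filter_upwards [hnn, ae_all_iff.2 hgae] with e he0 he
      have hpos : ∀ t, 0 < 1 + 15 * max (e t) 0 := fun t => by
        have := le_max_right (e t) 0; linarith
      refine (gibbs_code P hP0 hP1 (G e) B (fun w => hgB w e) (fun t => (1 + 15 * max (e t) 0) ^ (-(1 + 1 / N)))
        (fun t => Real.rpow_pos_of_pos (hpos t) _) (N / 15) (by positivity)).trans ?_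
      simp only [U]
      gcongr with w _
      · exact hP0 w
      · rw [Real.log_rpow (hpos _), neg_mul, neg_neg]
        refine mul_le_mul_of_nonneg_left ?_ (by positivity)
        rw [Finset.sum_eq_single (g w e), Set.indicator_of_mem (he w), max_eq_left (he0 _)]
        · exact tangent (he0 _) (div_nonneg (hk0 _ _) (hl _).le)
        · intro t _ hne
          exact Set.indicator_of_notMem (fun h => hne (hg w t e h).symm) _
        · simp
    rw [e1]
    have hUi : Integrable U ν := ((hi2.add (integrable_const _)).add hi4).sub (integrable_const _)
    refine (integral_mono_ae (by
      have := Integrable.of_finite (μ := ν.map G) (f := fun f => HH P f)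
      exact this.comp_measurable hGm) hUi hle).trans ?_
    have : ∫ e, U e ∂ν = ∫ e, ∑ w, P w * ((1 + 1 / N) * ∑ t, (raceSet l (k w) t).indicator (fun e => T w t (e t)) e) ∂ν
        + Real.log (N / 15) + ∫ e : τ → ℝ, (∑ t ∈ B, (1 + 15 * max (e t) 0) ^ (-(1 + 1 / N))) / (N / 15) ∂ν - 1 := by
      simp only [U]
      have h_a : Integrable (fun e => ∑ w, P w * ((1 + 1 / N) * ∑ t, (raceSet l (k w) t).indicator (fun e => T w t (e t)) e)
        + Real.log (N / 15)) ν := hi2.add (integrable_const _)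
      have h_b : Integrable (fun e => ∑ w, P w * ((1 + 1 / N) * ∑ t, (raceSet l (k w) t).indicator (fun e => T w t (e t)) e)
        + Real.log (N / 15) + (∑ t ∈ B, (1 + 15 * max (e t) 0) ^ (-(1 + 1 / N))) / (N / 15)) ν := h_a.add hi4
      rw [integral_sub h_b (integrable_const _),
        integral_add h_a hi4, integral_add hi2 (integrable_const _)]
      simp
    rw [this]
    have : (1 + 1 / N) * N = N + 1 := by field_simp
    linarith

lemma push_push {α β γ : Type} [Fintype α] [Fintype β] [DecidableEq β] [DecidableEq γ]
    (p : α → ℝ) (m : α → β) (g : β → γ) : push (push p m) g = push p (fun a => g (m a)) := by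
  funext c
  have := push_sum_mul p m (fun b => if g b = c then 1 else 0)
  simpa [push] using this

lemma HH_push {α β γ : Type} [Fintype α] [Fintype β] [DecidableEq β] [Fintype γ] [DecidableEq γ]
    (p : α → ℝ) (m : α → β) (g : β → γ) : HH (push p m) g = HH p (fun a => g (m a)) := by
  unfold HH; rw [push_push]

lemma push_inj {α β γ : Type} [Fintype α] [DecidableEq β] [DecidableEq γ]
    (p : α → ℝ) (f : α → β) (g : β → γ) (hg : Function.Injective g) (b : β) :
    push p (fun a => g (f a)) (g b) = push p f b := by
  unfold push; simp [hg.eq_iff]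

lemma HH_inj {α β γ : Type} [Fintype α] [Fintype β] [DecidableEq β] [Fintype γ] [DecidableEq γ]
    (p : α → ℝ) (f : α → β) (g : β → γ) (hg : Function.Injective g) :
    HH p (fun a => g (f a)) = HH p f := by
  unfold HH
  symm
  refine Fintype.sum_of_injective g hg _ _ ?_ ?_
  · intro c hc
    have : push p (fun a => g (f a)) c = 0 := Finset.sum_eq_zero fun a _ => by
      rw [if_neg]; rintro rfl; exact hc ⟨f a, rfl⟩
    simp [this]
  · intro b; rw [push_inj p f g hg]

lemma HH_const {α β : Type} [Fintype α] [Fintype β] [DecidableEq β]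
    (p : α → ℝ) (hp : ∑ a, p a = 1) (c : β) : HH p (fun _ => c) = 0 := by
  unfold HH
  refine Finset.sum_eq_zero fun b _ => ?_
  by_cases h : c = b
  · simp [push, h, hp]
  · simp [push, h]

lemma HH_eq {α β : Type} [Fintype α] [Fintype β] [DecidableEq β] (p : α → ℝ) (f : α → β) :
    HH p f = ∑ a, p a * (-Real.log (push p f (f a))) := by
  rw [← push_sum_mul p f (fun b => -Real.log (push p f b))]
  unfold HH Real.negMulLog
  exact Finset.sum_congr rfl fun b _ => by ring

lemma le_push {α β : Type} [Fintype α] [DecidableEq β] {p : α → ℝ} (hp : ∀ a, 0 ≤ p a)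
    (f : α → β) (a : α) : p a ≤ push p f (f a) := by
  classical
  have := Finset.single_le_sum (f := fun a' => if f a' = f a then p a' else 0)
    (fun a' _ => by split_ifs <;> simp [hp]) (Finset.mem_univ a)
  simpa [push] using this

lemma push_le_push {α β γ : Type} [Fintype α] [DecidableEq β] [DecidableEq γ] {p : α → ℝ} (hp : ∀ a, 0 ≤ p a)
    (f : α → β) (g : β → γ) (b : β) : push p f b ≤ push p (fun a => g (f a)) (g b) := by
  refine Finset.sum_le_sum fun a _ => ?_
  split_ifs with h1 h2 h2
  · exact le_rfl
  · exact absurd (congrArg g h1) h2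
  · exact hp a
  · exact le_rfl

lemma HH_le {α β γ : Type} [Fintype α] [Fintype β] [DecidableEq β] [Fintype γ] [DecidableEq γ]
    {p : α → ℝ} (hp : ∀ a, 0 ≤ p a) (f : α → β) (g : β → γ) :
    HH p (fun a => g (f a)) ≤ HH p f := by
  rw [HH_eq, HH_eq]
  refine Finset.sum_le_sum fun a _ => ?_
  rcases (hp a).eq_or_lt with h | h
  · simp [← h]
  · refine mul_le_mul_of_nonneg_left (neg_le_neg (Real.log_le_log (h.trans_le (le_push hp f a)) ?_)) h.le
    exact push_le_push hp f g (f a)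

lemma push_marg {α β γ : Type} [Fintype α] [DecidableEq β] [DecidableEq γ] [Fintype γ]
    (p : α → ℝ) (f : α → β) (g : α → γ) (b : β) : ∑ c, push p (fun a => (f a, g a)) (b, c) = push p f b := by
  unfold push
  rw [Finset.sum_comm]
  refine Finset.sum_congr rfl fun a _ => ?_
  by_cases h : f a = b <;> simp [h]

lemma HH_submod {α β γ δ : Type} [Fintype α] [Fintype β] [DecidableEq β] [Fintype γ] [DecidableEq γ]
    [Fintype δ] [DecidableEq δ]
    {p : α → ℝ} (hp : ∀ a, 0 ≤ p a) (x : α → β) (y : α → γ) (s : α → δ) :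
    HH p (fun a => (x a, y a, s a)) + HH p x ≤ HH p (fun a => (x a, s a)) + HH p (fun a => (x a, y a)) := by
  set q3 := push p (fun a => (x a, y a, s a)) with hq3
  set q1 := push p x with hq1
  set qs := push p (fun a => (x a, s a)) with hqs
  set qy := push p (fun a => (x a, y a)) with hqy
  have n3 : ∀ b, 0 ≤ q3 b := push_nonneg hp _
  have n1 : ∀ b, 0 ≤ q1 b := push_nonneg hp _
  have ns : ∀ b, 0 ≤ qs b := push_nonneg hp _
  have ny : ∀ b, 0 ≤ qy b := push_nonneg hp _
  have key : ∑ a, p a * (qs (x a, s a) * qy (x a, y a) / (q3 (x a, y a, s a) * q1 (x a))) ≤ ∑ a, p a := by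
    rw [← push_sum_mul p (fun a => (x a, y a, s a))
      (fun b => qs (b.1, b.2.2) * qy (b.1, b.2.1) / (q3 b * q1 b.1)), ← push_sum p x]
    calc _ ≤ ∑ b : β × γ × δ, qs (b.1, b.2.2) * qy (b.1, b.2.1) / q1 b.1 := by
          refine Finset.sum_le_sum fun b _ => ?_
          rw [← hq3]
          rcases (n3 b).eq_or_lt with h | h
          · rw [← h, zero_mul]; exact div_nonneg (mul_nonneg (ns _) (ny _)) (n1 _)
          · refine le_of_eq ?_
            rw [mul_div_assoc', mul_div_mul_left _ _ h.ne']
      _ ≤ ∑ b, q1 b := by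
          rw [Fintype.sum_prod_type]
          refine Finset.sum_le_sum fun b _ => ?_
          rw [Fintype.sum_prod_type]
          simp only
          have e1 : ∀ c, ∑ d, qs (b, d) * qy (b, c) / q1 b = q1 b * qy (b, c) / q1 b := fun c => by
            rw [← Finset.sum_div, ← Finset.sum_mul, hqs, push_marg]
          rw [Finset.sum_congr rfl fun c _ => e1 c, ← Finset.sum_div, ← Finset.mul_sum, hqy, push_marg]
          rw [← hq1]
          exact (mul_self_div_self (q1 b)).le
  have : ∑ a, (p a - p a * (qs (x a, s a) * qy (x a, y a) / (q3 (x a, y a, s a) * q1 (x a)))) ≤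
      (HH p (fun a => (x a, s a)) + HH p (fun a => (x a, y a))) - (HH p (fun a => (x a, y a, s a)) + HH p x) := by
    simp only [HH_eq]
    rw [← Finset.sum_add_distrib, ← Finset.sum_add_distrib, ← Finset.sum_sub_distrib]
    refine Finset.sum_le_sum fun a _ => ?_
    rcases (hp a).eq_or_lt with h | h
    · simp [← h]
    · have p3 : 0 < q3 (x a, y a, s a) := h.trans_le (le_push hp (fun a => (x a, y a, s a)) a)
      have p1 : 0 < q1 (x a) := h.trans_le (le_push hp _ a)
      have ps : 0 < qs (x a, s a) := h.trans_le (le_push hp (fun a => (x a, s a)) a)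
      have py : 0 < qy (x a, y a) := h.trans_le (le_push hp (fun a => (x a, y a)) a)
      have h1 := Real.log_le_sub_one_of_pos (div_pos (mul_pos ps py) (mul_pos p3 p1))
      rw [Real.log_div (by positivity) (by positivity), Real.log_mul ps.ne' py.ne', Real.log_mul p3.ne' p1.ne'] at h1
      rw [← hq3, ← hq1, ← hqs, ← hqy]
      have := mul_le_mul_of_nonneg_left h1 h.le
      linarith
  rw [Finset.sum_sub_distrib] at this
  linarith

/-- joint law of an index and a conditional law -/
noncomputable def joint {υ ζ : Type} (q : υ → ℝ) (R : υ → ζ → ℝ) : υ × ζ → ℝ := fun a => q a.1 * R a.1 a.2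

lemma joint_fst {υ ζ : Type} [Fintype υ] [Fintype ζ] [DecidableEq υ] (q : υ → ℝ) (R : υ → ζ → ℝ)
    (hR : ∀ y, ∑ z, R y z = 1) (y : υ) : push (joint q R) Prod.fst y = q y := by
  unfold push joint
  rw [Fintype.sum_prod_type, Finset.sum_eq_single y]
  · simp [← Finset.mul_sum, hR]
  · intro b _ hb; simp [hb]
  · simp

lemma joint_pair {υ ζ β : Type} [Fintype υ] [Fintype ζ] [DecidableEq υ] [DecidableEq β]
    (q : υ → ℝ) (R : υ → ζ → ℝ) (g : ζ → β) (y : υ) (b : β) :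
    push (joint q R) (fun a => (a.1, g a.2)) (y, b) = q y * push (R y) g b := by
  unfold push joint
  rw [Fintype.sum_prod_type, Finset.sum_eq_single y]
  · simp [Finset.mul_sum]
  · intro b _ hb; simp [hb]
  · simp

lemma joint_snd {υ ζ : Type} [Fintype υ] [Fintype ζ] [DecidableEq ζ] (q : υ → ℝ) (R : υ → ζ → ℝ)
    (z : ζ) : push (joint q R) Prod.snd z = ∑ y, q y * R y z := by
  unfold push joint
  rw [Fintype.sum_prod_type]
  simp

lemma HH_joint {υ ζ β : Type} [Fintype υ] [Fintype ζ] [DecidableEq υ] [Fintype β] [DecidableEq β]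
    (q : υ → ℝ) (R : υ → ζ → ℝ) (hR : ∀ y, ∑ z, R y z = 1) (g : ζ → β) :
    HH (joint q R) (fun a => (a.1, g a.2)) = HH (joint q R) Prod.fst + ∑ y, q y * HH (R y) g := by
  unfold HH
  rw [Fintype.sum_prod_type, ← Finset.sum_add_distrib]
  refine Finset.sum_congr rfl fun y _ => ?_
  simp only [joint_pair, Real.negMulLog_mul, joint_fst q R hR]
  rw [Finset.sum_add_distrib, ← Finset.sum_mul, push_sum, hR, one_mul, Finset.mul_sum]

lemma ent_eq_s15 {Ω γ β : Type} [MeasurableSpace Ω] (μ : Measure Ω) [IsProbabilityMeasure μ] [Fintype γ]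
    [MeasurableSpace γ] [MeasurableSingletonClass γ] [Fintype β] [DecidableEq β]
    (Z : Ω → γ) (hZ : Measurable Z) (f : γ → β) :
    ent μ (fun ω => f (Z ω)) = HH (fun a => μ.real (Z ⁻¹' {a})) f / Real.log 2 := by
  unfold ent HH
  rw [Finset.sum_div]
  refine Finset.sum_congr rfl fun b _ => ?_
  have : (μ ((fun ω => f (Z ω)) ⁻¹' {b})).toReal = push (fun a => μ.real (Z ⁻¹' {a})) f b := by
    have := Measure.isProbabilityMeasure_map (μ := μ) hZ.aemeasurable
    unfold push
    rw [← Finset.sum_filter]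
    have e : ∀ a, μ.real (Z ⁻¹' {a}) = (μ.map Z).real {a} := fun a =>
      (map_measureReal_apply hZ (measurableSet_singleton a)).symm
    simp_rw [e]
    rw [sum_measureReal_singleton, map_measureReal_apply hZ (Set.toFinite _).measurableSet, measureReal_def]
    congr 2
    ext ω; simp
  rw [this, Real.negMulLog, Real.logb]; ring

lemma sfrl2 {α ω τ : Type} [Fintype α] [Fintype ω] [DecidableEq ω] [Fintype τ] [DecidableEq τ] (J : α → ℝ)
    (hJ0 : ∀ a, 0 ≤ J a) (hJ1 : ∑ a, J a = 1) (f : α → ω) (g : α → τ) (I : ℝ)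
    (hI : I = HH J f + HH J g - HH J (fun a => (f a, g a))) :
    ∃ Q : (ω → τ) → ℝ, (∀ F, 0 ≤ Q F) ∧ (∑ F, Q F = 1) ∧
      (∀ w t, push J f w * ∑ F, (if F w = t then Q F else 0) = push J (fun a => (f a, g a)) (w, t)) ∧
      0 ≤ I ∧
      ∑ F, Q F * HH (push J f) F ≤ I + Real.log 16 + 1 + Real.log ((I + Real.log 16) / 15) := by
  set P := push J f with hP
  set p := push J g with hp
  set q := push J (fun a => (f a, g a)) with hq
  have P0 : ∀ w, 0 ≤ P w := push_nonneg hJ0 _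
  have p0 : ∀ w, 0 ≤ p w := push_nonneg hJ0 _
  have q0 : ∀ w, 0 ≤ q w := push_nonneg hJ0 _
  have P1 : ∑ w, P w = 1 := by rw [hP, push_sum, hJ1]
  have p1 : ∑ w, p w = 1 := by rw [hp, push_sum, hJ1]
  have m1 : ∀ w, ∑ t, q (w, t) = P w := fun w => push_marg J f g w
  have m2 : ∀ t, ∑ w, q (w, t) = p t := fun t => by
    rw [hp, ← push_marg J g f t]
    refine Finset.sum_congr rfl fun w _ => ?_
    have := push_inj J (fun a => (g a, f a)) Prod.swap Prod.swap_injective (t, w)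
    simpa [hq] using this
  let k : ω → τ → ℝ := fun w t => if 0 < P w then q (w, t) / P w else p t
  have hk : ∀ w t, P w * k w t = q (w, t) := by
    intro w t
    simp only [k]
    split_ifs with h
    · field_simp
    · have h0 : P w = 0 := le_antisymm (not_lt.1 h) (P0 w)
      have : q (w, t) = 0 := by
        refine le_antisymm ?_ (q0 _)
        rw [← h0, ← m1 w]
        exact Finset.single_le_sum (f := fun t => q (w, t)) (fun t _ => q0 _) (Finset.mem_univ t)
      rw [this, h0, zero_mul]
  have hpk : ∀ t, p t = ∑ w, P w * k w t := fun t => by simp_rw [hk]; exact (m2 t).symm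
  have hqp : ∀ w t, q (w, t) ≤ p t := fun w t => by
    rw [← m2 t]
    exact Finset.single_le_sum (f := fun w => q (w, t)) (fun w _ => q0 _) (Finset.mem_univ w)
  have hqP : ∀ w t, q (w, t) ≤ P w := fun w t => by
    rw [← m1 w]
    exact Finset.single_le_sum (f := fun t => q (w, t)) (fun t _ => q0 _) (Finset.mem_univ t)
  have hII : ∑ w, P w * ∑ t, k w t * Real.log (k w t / p t) = I := by
    rw [hI, HH_eq, HH_eq, HH_eq, ← Finset.sum_add_distrib, ← Finset.sum_sub_distrib]
    rw [← hP, ← hp, ← hq]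
    have := push_sum_mul J (fun a => (f a, g a)) (fun b => Real.log (q b) - Real.log (P b.1) - Real.log (p b.2))
    rw [← hq, Fintype.sum_prod_type] at this
    simp only at this
    trans ∑ a, J a * (Real.log (q (f a, g a)) - Real.log (P (f a)) - Real.log (p (g a)))
    · rw [← this]
      refine Finset.sum_congr rfl fun w _ => ?_
      rw [Finset.mul_sum]
      refine Finset.sum_congr rfl fun t _ => ?_
      rw [← mul_assoc, hk]
      rcases (q0 (w, t)).eq_or_lt with h | h
      · simp [← h]
      · have hpp := h.trans_le (hqp w t)
        have hPp := h.trans_le (hqP w t)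
        simp only [k, if_pos hPp]
        rw [Real.log_div (by positivity) hpp.ne', Real.log_div h.ne' hPp.ne']
    · exact Finset.sum_congr rfl fun a _ => by ring
  obtain ⟨Q, h1, h2, h3, h4, h5⟩ := sfrl P P0 P1 k (fun w t => by
      simp only [k]; split_ifs
      · exact div_nonneg (q0 _) (P0 _)
      · exact p0 t) (fun w => by
      simp only [k]; split_ifs with h
      · rw [← Finset.sum_div, m1, div_self h.ne']
      · exact p1) p hpk (fun w t h => by
      simp only [k] at h; split_ifs at h with h'
      · refine lt_of_lt_of_le ?_ (hqp w t)
        by_contra hc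
        rw [le_antisymm (not_lt.1 hc) (q0 _)] at h; simp at h
      · exact h)
  rw [hII] at h4 h5
  exact ⟨Q, h1, h2, fun w t => by rw [h3, hk], h4, h5⟩

lemma core {𝒮 𝒳 𝒯 : Type} [Fintype 𝒮] [DecidableEq 𝒮] [Fintype 𝒳] [DecidableEq 𝒳]
    [Fintype 𝒯] [DecidableEq 𝒯] (P : 𝒮 × 𝒳 × 𝒯 → ℝ) (hP0 : ∀ z, 0 ≤ P z) (hP1 : ∑ z, P z = 1)
    (hs hw ht I e r a : ℝ) (hhs : hs = HH P (fun z => z.1)) (hhw : hw = HH P (fun z => (z.2.1, z.1)))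
    (hht : ht = HH P (fun z => z.2.2))
    (hI : I = hw + ht - HH P (fun z => ((z.2.1, z.1), z.2.2)))
    (he0 : 0 ≤ e) (he1 : e < hs) (ha0 : 0 ≤ a) (ha1 : a ≤ 1) (hr : r = a * (hw - hs + e)) :
    ∃ (𝒴 : Type) (_ : Fintype 𝒴) (_ : DecidableEq 𝒴) (J : 𝒴 × 𝒮 × 𝒳 × 𝒯 → ℝ),
      (∀ b, 0 ≤ J b) ∧ (∀ z, push J Prod.snd z = P z) ∧
      HH J Prod.fst + HH J (fun b => b.2.1) - HH J (fun b => (b.1, b.2.1)) ≤ e ∧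
      HH J (fun b => b.2.2.1) + HH J Prod.fst - HH J (fun b => (b.2.2.1, b.1)) ≤ r ∧
      ht - (1 - a) * I - a * (hs - e) - (Real.log 16 + 1 + Real.log ((I + Real.log 16) / 15)) ≤
        HH J Prod.fst + HH J (fun b => b.2.2.2) - HH J (fun b => (b.1, b.2.2.2)) := by
  obtain ⟨Q, Q0, Q1, Qm, I0, Qb⟩ := sfrl2 P hP0 hP1 (fun z => (z.2.1, z.1)) (fun z => z.2.2) I
    (by rw [hI, hhw, hht])
  obtain ⟨R, R0, R1, Rm, -, -⟩ := sfrl2 P hP0 hP1 (fun z => z.1) (fun z => z.2.1) _ rfl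
  set PW := push P (fun z => (z.2.1, z.1)) with hPW
  set PS := push P (fun z => z.1) with hPS
  have PW0 : ∀ w, 0 ≤ PW w := push_nonneg hP0 _
  have PS0 : ∀ w, 0 ≤ PS w := push_nonneg hP0 _
  have PW1 : ∑ w, PW w = 1 := by rw [hPW, push_sum, hP1]
  have PS1 : ∑ w, PS w = 1 := by rw [hPS, push_sum, hP1]
  have hspos : 0 < hs := he0.trans_lt he1
  set d := e / hs with hd
  have hd0 : 0 ≤ d := by positivity
  have hd1 : d ≤ 1 := by rw [hd, div_le_one hspos]; exact he1.le
  have hde : d * hs = e := by rw [hd]; field_simp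
  let 𝒴 := (𝒳 × 𝒮 → 𝒯) × Option ((𝒮 → 𝒳) × Option 𝒮)
  have dY : DecidableEq 𝒴 := Classical.decEq _
  let m : (𝒳 × 𝒮 → 𝒯) → (𝒮 → 𝒳) → 𝒮 → 𝒮 × 𝒳 × 𝒯 := fun f F s => (s, F s, f (F s, s))
  let q : 𝒴 → ℝ := fun y => match y with
    | (f, none) => Q f * (1 - a)
    | (f, some (F, none)) => Q f * (a * (1 - d) * R F)
    | (f, some (F, some s)) => Q f * (a * d * R F * PS s)
  let D : 𝒴 → 𝒮 × 𝒳 × 𝒯 → ℝ := fun y => match y with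
    | (f, none) => push PW (fun w => (w.2, w.1, f w))
    | (f, some (F, none)) => push PS (m f F)
    | (f, some (F, some s)) => push PS (fun _ => m f F s)
  have q0 : ∀ y, 0 ≤ q y := by
    rintro ⟨f, _ | ⟨F, _ | s⟩⟩
    · exact mul_nonneg (Q0 f) (by linarith)
    · exact mul_nonneg (Q0 f) (mul_nonneg (mul_nonneg ha0 (by linarith)) (R0 F))
    · exact mul_nonneg (Q0 f) (mul_nonneg (mul_nonneg (mul_nonneg ha0 hd0) (R0 F)) (PS0 s))
  have D0 : ∀ y z, 0 ≤ D y z := by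
    rintro ⟨f, _ | ⟨F, _ | s⟩⟩ z
    · exact push_nonneg PW0 _ z
    · exact push_nonneg PS0 _ z
    · exact push_nonneg PS0 _ z
  have D1 : ∀ y, ∑ z, D y z = 1 := by
    rintro ⟨f, _ | ⟨F, _ | s⟩⟩
    · exact (push_sum _ _).trans PW1
    · exact (push_sum _ _).trans PS1
    · exact (push_sum _ _).trans PS1
  have mix : ∀ h : 𝒴 → ℝ, ∑ y, q y * h y = (1 - a) * ∑ f, Q f * h (f, none)
      + a * (1 - d) * ∑ f, Q f * ∑ F, R F * h (f, some (F, none))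
      + a * d * ∑ f, Q f * ∑ F, R F * ∑ s, PS s * h (f, some (F, some s)) := by
    intro h
    rw [Fintype.sum_prod_type]
    simp only [Fintype.sum_option, Fintype.sum_prod_type, q]
    simp only [Finset.mul_sum, ← Finset.sum_add_distrib]
    refine Finset.sum_congr rfl fun f _ => ?_
    rw [Finset.sum_add_distrib, add_assoc]
    congr 1
    · ring
    · congr 1
      · exact Finset.sum_congr rfl fun F _ => by ring
      · exact Finset.sum_congr rfl fun F _ => Finset.sum_congr rfl fun s _ => by ring
  have base : ∀ s x t, PW (x, s) * ∑ f, (if f (x, s) = t then Q f else 0) = P (s, x, t) := by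
    intro s x t
    rw [Qm (x, s) t]
    have := push_inj P id (fun z : 𝒮 × 𝒳 × 𝒯 => ((z.2.1, z.1), z.2.2)) (by
      rintro ⟨s, x, t⟩ ⟨s', x', t'⟩ h; simp at h ⊢; tauto) (s, x, t)
    rw [show ((x, s), t) = (fun z : 𝒮 × 𝒳 × 𝒯 => ((z.2.1, z.1), z.2.2)) (s, x, t) from rfl]
    refine Eq.trans this ?_
    simp [push]
  have baseR : ∀ s x, PS s * ∑ F, (if F s = x then R F else 0) = PW (x, s) := by
    intro s x
    rw [Rm s x]
    exact (push_inj P (fun z => (z.1, z.2.1)) Prod.swap Prod.swap_injective (s, x)).symm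
  have pm : ∀ f F s x t, push PS (m f F) (s, x, t) = PS s * (if F s = x then 1 else 0) * (if f (x, s) = t then 1 else 0) := by
    intro f F s x t
    unfold push
    rw [Finset.sum_eq_single s]
    · by_cases h1 : F s = x
      · subst h1; by_cases h2 : f (F s, s) = t <;> simp [m, h2]
      · simp [m, h1]
    · intro b _ hb; simp [m, hb]
    · simp
  have part2 : ∀ z, ∑ f, Q f * ∑ F, R F * push PS (m f F) z = P z := by
    rintro ⟨s, x, t⟩
    rw [← base, ← baseR, Finset.mul_sum]
    refine Finset.sum_congr rfl fun f _ => ?_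
    simp only [pm]
    rw [Finset.mul_sum, Finset.mul_sum, Finset.sum_mul]
    refine Finset.sum_congr rfl fun F _ => ?_
    split_ifs <;> ring
  have part1 : ∀ z, ∑ f, Q f * push PW (fun w => (w.2, w.1, f w)) z = P z := by
    rintro ⟨s, x, t⟩
    rw [← base, Finset.mul_sum]
    refine Finset.sum_congr rfl fun f _ => ?_
    have : push PW (fun w => (w.2, w.1, f w)) (s, x, t) = PW (x, s) * (if f (x, s) = t then 1 else 0) := by
      unfold push
      rw [Finset.sum_eq_single (x, s)]
      · simp
      · rintro ⟨b1, b2⟩ _ hb; rw [if_neg]; intro h; simp at h hb; tauto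
      · simp
    rw [this]; split_ifs <;> ring
  have part3 : ∀ z, ∑ f, Q f * ∑ F, R F * ∑ s, PS s * push PS (fun _ => m f F s) z = P z := by
    intro z
    rw [← part2 z]
    refine Finset.sum_congr rfl fun f _ => ?_
    congr 1
    refine Finset.sum_congr rfl fun F _ => ?_
    congr 1
    refine Finset.sum_congr rfl fun s _ => ?_
    by_cases h : m f F s = z
    · simp [push, h, PS1]
    · simp [push, h]
  have hsnd : ∀ z, push (joint q D) Prod.snd z = P z := by
    intro z
    rw [joint_snd, mix (fun y => D y z)]
    simp only [D]
    rw [part1, part2, part3]; ring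
  have hsnd' : push (joint q D) Prod.snd = P := funext hsnd
  have J0 : ∀ b, 0 ≤ joint q D b := fun b => mul_nonneg (q0 _) (D0 _ _)
  have HJ : ∀ {β : Type} [Fintype β] [DecidableEq β] (g : 𝒮 × 𝒳 × 𝒯 → β),
      HH (joint q D) (fun b => g b.2) = HH P g := by
    intro β _ _ g
    rw [← HH_push (joint q D) Prod.snd g, hsnd']
  have HY : ∀ {β : Type} [Fintype β] [DecidableEq β] (g : 𝒮 × 𝒳 × 𝒯 → β),
      HH (joint q D) (fun b => (b.1, g b.2)) = HH (joint q D) Prod.fst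
        + ((1 - a) * ∑ f, Q f * HH PW (fun w => g (w.2, w.1, f w))
          + a * (1 - d) * ∑ f, Q f * ∑ F, R F * HH PS (fun s => g (m f F s))) := by
    intro β _ _ g
    rw [HH_joint q D D1, mix]
    congr 1
    simp only [D, HH_push, HH_const _ PS1]
    simp
  have avg : ∀ c : ℝ, ∑ f, Q f * ∑ F, R F * c = c := fun c => by
    simp_rw [← Finset.sum_mul]; rw [R1, Q1]; ring
  have avgQ : ∀ c : ℝ, ∑ f, Q f * c = c := fun c => by
    simp_rw [← Finset.sum_mul]; rw [Q1]; ring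
  have HSS : ∀ f F, HH PS (fun s => (m f F s).1) = hs := by
    intro f F
    change HH PS (fun s => s) = hs
    rw [hPS, HH_push, hhs]
  have HWS : ∀ f : 𝒳 × 𝒮 → 𝒯, HH PW (fun w => w.2) = hs := by
    intro f
    rw [hPW, HH_push, hhs]
  have HSW : ∀ f F, HH PS (fun s => ((m f F s).2.1, (m f F s).1)) = hs := by
    intro f F
    rw [← HSS f F]
    exact HH_inj PS (fun s => s) (fun s => (F s, s)) (fun s s' h => (Prod.mk.inj h).2)
  refine ⟨𝒴, inferInstance, dY, joint q D, J0, hsnd, ?_, ?_, ?_⟩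
  · rw [HY (fun z => z.1), HJ (fun z => z.1), ← hhs]
    simp only [HSS, HWS]
    rw [avg]
    have : ∑ f, Q f * HH PW (fun w : 𝒳 × 𝒮 => w.2) = hs := by
      rw [← avgQ hs]; exact Finset.sum_congr rfl fun f _ => by rw [HWS f]
    rw [this]
    have h2 : a * e ≤ 1 * e := mul_le_mul_of_nonneg_right ha1 he0
    have : hs - ((1 - a) * hs + a * (1 - d) * hs) = a * (d * hs) := by ring
    rw [hde] at this
    linarith
  · have h1 := HH_submod J0 (fun b => b.2.2.1) (fun b => b.1) (fun b => b.2.1)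
    have h2 : HH (joint q D) (fun b => (b.2.2.1, b.1, b.2.1)) = HH (joint q D) (fun b => (b.1, (b.2.2.1, b.2.1))) :=
      HH_inj (joint q D) (fun b => (b.1, (b.2.2.1, b.2.1))) (fun c : 𝒴 × 𝒳 × 𝒮 => (c.2.1, c.1, c.2.2)) (by
        rintro ⟨s, x, t⟩ ⟨s', x', t'⟩ h; simp at h ⊢; tauto)
    rw [h2, HY (fun z => (z.2.1, z.1)), HJ (fun z => (z.2.1, z.1)), ← hhw] at h1
    simp only [HSW] at h1
    rw [avg] at h1
    have h3 : HH PW (fun w : 𝒳 × 𝒮 => (w.1, w.2)) = hw := by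
      rw [hPW, HH_push, hhw]
    rw [h3, avgQ] at h1
    have : (1 - a) * hw + a * (1 - d) * hs = hw - a * (hw - hs + d * hs) := by ring
    rw [hde, ← hr] at this
    linarith
  · rw [HY (fun z => z.2.2), HJ (fun z => z.2.2), ← hht]
    have h1 : ∑ f, Q f * ∑ F, R F * HH PS (fun s => (m f F s).2.2) ≤ hs := by
      rw [← avg hs]
      refine Finset.sum_le_sum fun f _ => mul_le_mul_of_nonneg_left
        (Finset.sum_le_sum fun F _ => mul_le_mul_of_nonneg_left ?_ (R0 F)) (Q0 f)
      have := HH_le PS0 (fun s => s) (fun s => (m f F s).2.2)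
      rwa [show HH PS (fun s => s) = hs from HSS f F] at this
    have h2 : (1 - a) * ∑ f, Q f * HH PW (fun w => f w) ≤ (1 - a) * (I + Real.log 16 + 1 + Real.log ((I + Real.log 16) / 15)) :=
      mul_le_mul_of_nonneg_left Qb (by linarith)
    have h3 := mul_le_mul_of_nonneg_left h1 (mul_nonneg ha0 (by linarith : 0 ≤ 1 - d))
    have h4 : 0 ≤ Real.log 16 + 1 + Real.log ((I + Real.log 16) / 15) := by
      have l2 := Real.log_two_gt_d9
      have l16 : Real.log 16 = 4 * Real.log 2 := by
        rw [show (16:ℝ) = 2 ^ 4 by norm_num, Real.log_pow]; norm_num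
      have : Real.log (1 / 16) ≤ Real.log ((I + Real.log 16) / 15) :=
        Real.log_le_log (by norm_num) (by rw [l16]; linarith)
      rw [one_div, Real.log_inv] at this
      linarith
    have h5 := mul_nonneg ha0 h4
    have h6 : a * (1 - d) * hs = a * (hs - d * hs) := by ring
    rw [hde] at h6
    linarith

lemma numeric {I M : ℝ} (hI : 0 ≤ I) (hM : I ≤ M) :
    (Real.log 16 + 1 + Real.log ((I * Real.log 2 + Real.log 16) / 15)) / Real.log 2
      ≤ 1.06 + Real.logb 2 (M + 5.51) := by
  have l2 := Real.log_two_gt_d9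
  have l2' := Real.log_two_lt_d9
  have l16 : Real.log 16 = 4 * Real.log 2 := by
    rw [show (16:ℝ) = 2 ^ 4 by norm_num, Real.log_pow]; norm_num
  have hl : 0 < Real.log 2 := by linarith
  rw [div_le_iff₀ hl, add_mul, Real.logb, div_mul_cancel₀ _ hl.ne']
  have e1 : Real.log 16 + Real.log ((I * Real.log 2 + Real.log 16) / 15)
      = Real.log (I + 4) + Real.log (16 / 15 * Real.log 2) := by
    rw [← Real.log_mul (by norm_num) (by rw [l16]; positivity), ← Real.log_mul (by positivity) (by positivity), l16]
    congr 1; ring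
  have e2 : Real.log (I + 4) ≤ Real.log (M + 5.51) := Real.log_le_log (by linarith) (by linarith)
  have e3 : Real.log (16 / 15 * Real.log 2) ≤ Real.log (0.93 ^ 4) := Real.log_le_log (by positivity) (by
    norm_num; linarith)
  have e4 := Real.log_le_sub_one_of_pos (show (0:ℝ) < 0.93 by norm_num)
  rw [Real.log_pow] at e3
  norm_num at e3 e4 ⊢
  linarith


/-- **Lower bound `L₂^{r,ε}` of Theorem 2.** For `0 ≤ ε < min{I(S;X), H(S)}`, `0 ≤ r ≤ H(X|S) + ε` and `α = r / (H(X|S) + ε)`, there is a representation `Y` with `I(Y;S') ≤ ε`, `I(X';Y) ≤ r`, and `I(Y;T') ≥ H(T|(X,S)) + r − α H((X,S)|T) − 1.06 − log₂((1−α) I((X,S);T) + α min{H(T), H(X,S)} + 5.51)`. -/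
theorem lower_bound_L2re
    {Ω 𝒮 𝒳 𝒯 : Type} [MeasurableSpace Ω] (μ : Measure Ω) [IsProbabilityMeasure μ]
    [Fintype 𝒮] [MeasurableSpace 𝒮] [MeasurableSingletonClass 𝒮]
    [Fintype 𝒳] [MeasurableSpace 𝒳] [MeasurableSingletonClass 𝒳]
    [Fintype 𝒯] [MeasurableSpace 𝒯] [MeasurableSingletonClass 𝒯]
    (S : Ω → 𝒮) (X : Ω → 𝒳) (T : Ω → 𝒯)
    (hS : Measurable S) (hX : Measurable X) (hT : Measurable T)
    (ε : ℝ) (hε0 : 0 ≤ ε) (hε1 : ε < min (mutInf μ S X) (ent μ S))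
    (r : ℝ) (hr0 : 0 ≤ r) (hr1 : r ≤ condEnt μ X S + ε) :
    ∃ (Ω' : Type) (_ : MeasurableSpace Ω') (μ' : Measure Ω')
      (𝒴 : Type) (_ : Fintype 𝒴) (_ : MeasurableSpace 𝒴)
      (S' : Ω' → 𝒮) (X' : Ω' → 𝒳) (T' : Ω' → 𝒯) (Y : Ω' → 𝒴),
      IsProbabilityMeasure μ' ∧
      Measurable S' ∧ Measurable X' ∧ Measurable T' ∧ Measurable Y ∧
      IdentDistrib (fun ω => (S ω, X ω, T ω)) (fun ω => (S' ω, X' ω, T' ω)) μ μ' ∧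
      mutInf μ' Y S' ≤ ε ∧ mutInf μ' X' Y ≤ r ∧
      mutInf μ' Y T' ≥
        condEnt μ T (fun ω => (X ω, S ω)) + r
          - (r / (condEnt μ X S + ε)) * condEnt μ (fun ω => (X ω, S ω)) T - 1.06
          - Real.logb 2 ((1 - r / (condEnt μ X S + ε)) * mutInf μ (fun ω => (X ω, S ω)) T
              + (r / (condEnt μ X S + ε)) * min (ent μ T) (ent μ (fun ω => (X ω, S ω))) + 5.51) := by
  classical
  let Z : Ω → 𝒮 × 𝒳 × 𝒯 := fun ω => (S ω, X ω, T ω)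
  have hZ : Measurable Z := hS.prodMk (hX.prodMk hT)
  set P : 𝒮 × 𝒳 × 𝒯 → ℝ := fun z => μ.real (Z ⁻¹' {z}) with hP
  have hP0 : ∀ z, 0 ≤ P z := fun z => measureReal_nonneg
  have hP1 : ∑ z, P z = 1 := by
    have := Measure.isProbabilityMeasure_map (μ := μ) hZ.aemeasurable
    have e : ∀ a, P a = (μ.map Z).real {a} := fun a =>
      (map_measureReal_apply hZ (measurableSet_singleton a)).symm
    simp_rw [e]
    rw [sum_measureReal_singleton]; simp
  have hl : 0 < Real.log 2 := Real.log_pos (by norm_num)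
  have ES : ent μ S = HH P (fun z => z.1) / Real.log 2 := ent_eq_s15 μ Z hZ (fun z => z.1)
  have ET : ent μ T = HH P (fun z => z.2.2) / Real.log 2 := ent_eq_s15 μ Z hZ (fun z => z.2.2)
  have EW : ent μ (fun ω => (X ω, S ω)) = HH P (fun z => (z.2.1, z.1)) / Real.log 2 :=
    ent_eq_s15 μ Z hZ (fun z => (z.2.1, z.1))
  have EWT : ent μ (fun ω => ((X ω, S ω), T ω)) = HH P (fun z => ((z.2.1, z.1), z.2.2)) / Real.log 2 :=
    ent_eq_s15 μ Z hZ (fun z => ((z.2.1, z.1), z.2.2))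
  have ETW : ent μ (fun ω => (T ω, X ω, S ω)) = HH P (fun z => ((z.2.1, z.1), z.2.2)) / Real.log 2 := by
    rw [← HH_inj P (fun z => ((z.2.1, z.1), z.2.2)) Prod.swap Prod.swap_injective]
    exact ent_eq_s15 μ Z hZ (fun z => (z.2.2, z.2.1, z.1))
  have leSW : HH P (fun z => z.1) ≤ HH P (fun z => (z.2.1, z.1)) :=
    HH_le hP0 (fun z => (z.2.1, z.1)) Prod.snd
  have leW : HH P (fun z => (z.2.1, z.1)) ≤ HH P (fun z => ((z.2.1, z.1), z.2.2)) :=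
    HH_le hP0 (fun z => ((z.2.1, z.1), z.2.2)) Prod.fst
  have leT : HH P (fun z => z.2.2) ≤ HH P (fun z => ((z.2.1, z.1), z.2.2)) :=
    HH_le hP0 (fun z => ((z.2.1, z.1), z.2.2)) Prod.snd
  have hXS : condEnt μ X S = ent μ (fun ω => (X ω, S ω)) - ent μ S := rfl
  have hTW : condEnt μ T (fun ω => (X ω, S ω)) = ent μ (fun ω => (T ω, X ω, S ω)) - ent μ (fun ω => (X ω, S ω)) := rfl
  have hWT : condEnt μ (fun ω => (X ω, S ω)) T = ent μ (fun ω => ((X ω, S ω), T ω)) - ent μ T := rfl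
  have hIWT : mutInf μ (fun ω => (X ω, S ω)) T = ent μ (fun ω => (X ω, S ω)) + ent μ T
    - ent μ (fun ω => ((X ω, S ω), T ω)) := rfl
  have hε2 : ε < ent μ S := hε1.trans_le (min_le_right _ _)
  clear hε1
  rw [hTW, hWT, hIWT, hXS]
  rw [hXS] at hr1
  clear hTW hWT hIWT hXS
  rw [ETW, EWT, EW, ES, ET]
  rw [EW, ES] at hr1
  rw [ES] at hε2
  clear ETW EWT EW ES ET
  generalize hhs : HH P (fun z => z.1) = hs at *
  generalize hhw : HH P (fun z => (z.2.1, z.1)) = hw at *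
  generalize hht : HH P (fun z => z.2.2) = ht at *
  generalize hhwt : HH P (fun z => ((z.2.1, z.1), z.2.2)) = hwt at *
  set a := r / (hw / Real.log 2 - hs / Real.log 2 + ε) with ha
  have hden : 0 ≤ hw / Real.log 2 - hs / Real.log 2 + ε := hr0.trans hr1
  have ha0 : 0 ≤ a := div_nonneg hr0 hden
  have ha1 : a ≤ 1 := div_le_one_of_le₀ hr1 hden
  have har : r = a * (hw / Real.log 2 - hs / Real.log 2 + ε) := by
    rcases hden.eq_or_lt with h | h
    · rw [← h]; rw [← h] at hr1; linarith
    · rw [ha, div_mul_cancel₀ _ h.ne']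
  obtain ⟨𝒴, _, _, J, J0, Jsnd, J1, J2, J3⟩ := core P hP0 hP1 hs hw ht (hw + ht - hwt) (ε * Real.log 2)
    (r * Real.log 2) a hhs.symm hhw.symm hht.symm (by rw [hhwt]) (by positivity)
    (by rwa [lt_div_iff₀ hl] at hε2) ha0 ha1 (by rw [har]; field_simp)
  have hI0 : 0 ≤ hw + ht - hwt := by
    have := (sfrl2 P hP0 hP1 (fun z => (z.2.1, z.1)) (fun z => z.2.2) (hw + ht - hwt)
      (by rw [hhw, hht, hhwt]))
    obtain ⟨_, _, _, _, h, _⟩ := this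
    exact h
  letI m1 : MeasurableSpace (𝒴 × 𝒮 × 𝒳 × 𝒯) := ⊤
  letI mY : MeasurableSpace 𝒴 := ⊤
  let μ' : @Measure (𝒴 × 𝒮 × 𝒳 × 𝒯) m1 := ∑ b, ENNReal.ofReal (J b) • @Measure.dirac _ m1 b
  have hsing : @MeasurableSingletonClass (𝒴 × 𝒮 × 𝒳 × 𝒯) m1 := ⟨fun _ => trivial⟩
  have hμ' : ∀ b, @Measure.real _ m1 μ' {b} = J b := by
    intro b
    rw [measureReal_def]
    simp only [μ', Measure.coe_finsetSum, Finset.sum_apply, Measure.smul_apply, smul_eq_mul]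
    rw [Finset.sum_eq_single b]
    · simp [J0]
    · intro c _ hc
      rw [Measure.dirac_apply' _ (measurableSet_singleton b)]; simp [hc]
    · simp
  have hJ1 : ∑ b, J b = 1 := by
    rw [← push_sum J Prod.snd, ← hP1]; exact Finset.sum_congr rfl fun z _ => Jsnd z
  have hprob : @IsProbabilityMeasure _ m1 μ' := ⟨by
    simp only [μ', Measure.coe_finsetSum, Finset.sum_apply, Measure.smul_apply, smul_eq_mul]
    simp only [measure_univ, mul_one]
    rw [← ENNReal.ofReal_sum_of_nonneg fun b _ => J0 b, hJ1]; simp⟩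
  have hmeas : ∀ {γ : Type} [MeasurableSpace γ] (f : 𝒴 × 𝒮 × 𝒳 × 𝒯 → γ), @Measurable _ _ m1 _ f :=
    fun f _ _ => trivial
  have E : ∀ {β : Type} [Fintype β] (f : 𝒴 × 𝒮 × 𝒳 × 𝒯 → β), 
      @ent _ _ m1 _ μ' f = HH J f / Real.log 2 := by
    intro β _ f
    have := @ent_eq_s15 _ _ β m1 μ' hprob _ m1 hsing _ _ id (hmeas _) f
    simp only [Set.preimage_id, hμ'] at this
    exact this
  refine ⟨𝒴 × 𝒮 × 𝒳 × 𝒯, m1, μ', 𝒴, inferInstance, mY, fun b => b.2.1, fun b => b.2.2.1, fun b => b.2.2.2,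
    fun b => b.1, hprob, hmeas _, hmeas _, hmeas _, hmeas _, ?_, ?_, ?_, ?_⟩
  · refine ⟨hZ.aemeasurable, (hmeas _).aemeasurable, ?_⟩
    refine Measure.ext_of_singleton fun z => ?_
    have hfin := Measure.isProbabilityMeasure_map (μ := μ) hZ.aemeasurable
    have hfin' := @Measure.isProbabilityMeasure_map _ _ m1 _ μ' hprob (fun b => (b.2.1, b.2.2.1, b.2.2.2)) (hmeas _).aemeasurable
    have h1 : (μ.map Z).real {z} = P z := map_measureReal_apply hZ (measurableSet_singleton z)
    have h2 : (@Measure.map _ _ m1 _ (fun b => (b.2.1, b.2.2.1, b.2.2.2)) μ').real {z} = P z := by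
      rw [map_measureReal_apply (hmeas _) (measurableSet_singleton z), ← Jsnd z]
      unfold push
      simp_rw [← hμ']
      rw [← Finset.sum_filter, sum_measureReal_singleton]
      congr 1
      ext b; simp
    rw [← h1, measureReal_def, measureReal_def, ENNReal.toReal_eq_toReal_iff' (measure_ne_top _ _) (measure_ne_top _ _)] at h2
    exact h2.symm
  · unfold mutInf
    rw [E, E, E, ← add_div, ← sub_div, div_le_iff₀ hl]
    exact le_trans (le_of_eq (by congr!)) J1
  · unfold mutInf
    rw [E, E, E, ← add_div, ← sub_div, div_le_iff₀ hl]
    exact le_trans (le_of_eq (by congr!)) J2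
  · unfold mutInf
    rw [E, E, E, ← add_div, ← sub_div, ge_iff_le, le_div_iff₀ hl]
    refine le_trans ?_ (le_trans J3 (le_of_eq (by congr!)))
    have num := numeric (I := (hw + ht - hwt) / Real.log 2)
      (M := (1 - a) * (hw / Real.log 2 + ht / Real.log 2 - hwt / Real.log 2) + a * min (ht / Real.log 2) (hw / Real.log 2))
      (by positivity) (by
        have h1 : (hw + ht - hwt) / Real.log 2 ≤ min (ht / Real.log 2) (hw / Real.log 2) :=
          le_min (by gcongr; linarith) (by gcongr; linarith)
        have h2 := mul_le_mul_of_nonneg_left h1 ha0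
        have h3 : hw / Real.log 2 + ht / Real.log 2 - hwt / Real.log 2 = (hw + ht - hwt) / Real.log 2 := by ring
        rw [h3]
        linarith)
    rw [div_mul_cancel₀ _ hl.ne', div_le_iff₀ hl] at num
    generalize Real.logb 2 _ = LL at num ⊢
    have e1 : (hwt / Real.log 2 - hw / Real.log 2 + r - a * (hwt / Real.log 2 - ht / Real.log 2) - 1.06 - LL) * Real.log 2
      = hwt - hw + a * (hw - hs + ε * Real.log 2) - a * (hwt - ht) - (1.06 + LL) * Real.log 2 := by
      rw [har]; field_simp; ring
    rw [e1]
    linarith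
end

section
/- Lower bound L′₁^{r,ε} of Theorem 2 (high-rate regime): Let (S,X,T) be jointly distributed random variables with values in finite sets, let ε satisfy 0 ≤ ε < min{I(S;X), H(S)}, and let r satisfy H(X|S) + ε ≤ r < H(X). Then there exists a probability space carrying random variables (S',X',T',Y) such that (S',X',T') has the same joint distribution as (S,X,T), Y takes values in a finite set, I(Y;S') ≤ ε, I(X';Y) ≤ r, and I(Y;T') ≥ H(T|S) − H(S|T) + ε. -/
open MeasureTheory ProbabilityTheory

open Classical in
/-- Marginal weight. -/
noncomputable def marg {Ω α : Type*} [Fintype Ω] (w : Ω → ℝ) (f : Ω → α) (a : α) : ℝ :=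
  ∑ ω, if f ω = a then w ω else 0

set_option linter.unusedSectionVars false

section fin
variable {Ω α β γ : Type*} [Fintype Ω] [Fintype α] [Fintype β] [Fintype γ]

lemma marg_nonneg {w : Ω → ℝ} (hw : ∀ ω, 0 ≤ w ω) (f : Ω → α) (a : α) : 0 ≤ marg w f a := by
  unfold marg
  exact Finset.sum_nonneg fun ω _ => by split_ifs <;> simp [hw]

lemma le_marg {w : Ω → ℝ} (hw : ∀ ω, 0 ≤ w ω) (f : Ω → α) (ω : Ω) : w ω ≤ marg w f (f ω) := by
  classical
  unfold marg
  have := Finset.single_le_sum (f := fun ω' => if f ω' = f ω then w ω' else 0)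
    (fun ω' _ => by split_ifs <;> simp [hw]) (Finset.mem_univ ω)
  simpa using this

lemma sum_marg_mul (w : Ω → ℝ) (f : Ω → α) (F : α → ℝ) :
    ∑ a, marg w f a * F a = ∑ ω, w ω * F (f ω) := by
  classical
  unfold marg
  simp_rw [Finset.sum_mul]
  rw [Finset.sum_comm]
  refine Finset.sum_congr rfl fun ω _ => ?_
  simp [ite_mul]

lemma marg_mono {w : Ω → ℝ} (hw : ∀ ω, 0 ≤ w ω) (f : Ω → α) (g : Ω → β) (a : α) (b : β)
    (h : ∀ ω, f ω = a → g ω = b) : marg w f a ≤ marg w g b := by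
  unfold marg
  refine Finset.sum_le_sum fun ω _ => ?_
  split_ifs with h1 h2 h2
  · exact le_rfl
  · exact absurd (h ω h1) h2
  · exact hw ω
  · exact le_rfl

lemma marg_congr (w : Ω → ℝ) (f : Ω → α) (g : Ω → β) (a : α) (b : β)
    (h : ∀ ω, f ω = a ↔ g ω = b) : marg w f a = marg w g b := by
  unfold marg
  refine Finset.sum_congr rfl fun ω _ => ?_
  by_cases h1 : g ω = b
  · rw [if_pos ((h ω).2 h1), if_pos h1]
  · rw [if_neg (mt (h ω).1 h1), if_neg h1]

lemma marg_pair_sum (w : Ω → ℝ) (f : Ω → α) (g : Ω → β) (a : α) :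
    ∑ b, marg w (fun ω => (f ω, g ω)) (a, b) = marg w f a := by
  classical
  unfold marg
  rw [Finset.sum_comm]
  refine Finset.sum_congr rfl fun ω _ => ?_
  by_cases h : f ω = a <;> simp [h]

variable [MeasurableSpace Ω]

lemma ent_eq_s16 (μ : Measure Ω) (w : Ω → ℝ)
    (hμ : ∀ A : Set Ω, (μ A).toReal = ∑ ω, A.indicator w ω) (f : Ω → α) :
    ent μ f = ∑ ω, w ω * -(Real.logb 2 (marg w f (f ω))) := by
  have h : ∀ a, (μ (f ⁻¹' {a})).toReal = marg w f a := by
    intro a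
    rw [hμ]
    unfold marg
    refine Finset.sum_congr rfl fun ω _ => ?_
    by_cases h : f ω = a <;> simp [h]
  unfold ent
  simp_rw [h]
  rw [← sum_marg_mul w f (fun a => -(Real.logb 2 (marg w f a)))]
  simp

lemma ent_mono (μ : Measure Ω) (w : Ω → ℝ) (hw : ∀ ω, 0 ≤ w ω)
    (hμ : ∀ A : Set Ω, (μ A).toReal = ∑ ω, A.indicator w ω) (f : Ω → α) (g : Ω → β)
    (h : ∀ ω ω', f ω = f ω' → g ω = g ω') : ent μ g ≤ ent μ f := by
  rw [ent_eq_s16 μ w hμ, ent_eq_s16 μ w hμ]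
  refine Finset.sum_le_sum fun ω _ => ?_
  rcases (hw ω).eq_or_lt with h0 | h0
  · simp [← h0]
  refine mul_le_mul_of_nonneg_left (neg_le_neg ?_) (hw ω)
  exact Real.logb_le_logb_of_le (by norm_num) (h0.trans_le (le_marg hw f ω))
    (marg_mono hw _ _ _ _ fun ω' h' => h _ _ h')

lemma ent_submod_s16 (μ : Measure Ω) (w : Ω → ℝ) (hw : ∀ ω, 0 ≤ w ω) (h1 : ∑ ω, w ω = 1)
    (hμ : ∀ A : Set Ω, (μ A).toReal = ∑ ω, A.indicator w ω)
    (x : Ω → α) (y : Ω → β) (s : Ω → γ) :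
    ent μ (fun ω => (x ω, y ω, s ω)) + ent μ x
      ≤ ent μ (fun ω => (x ω, s ω)) + ent μ (fun ω => (x ω, y ω)) := by
  simp_rw [ent_eq_s16 μ w hμ, ← Finset.sum_add_distrib]
  rw [← sub_nonneg, ← Finset.sum_sub_distrib]
  set A := marg w (fun ω => (x ω, s ω)) with hA
  set B := marg w (fun ω => (x ω, y ω)) with hB
  set C := marg w (fun ω => (x ω, y ω, s ω)) with hC
  set D := marg w x with hD
  have hA0 : ∀ a, 0 ≤ A a := marg_nonneg hw _
  have hB0 : ∀ a, 0 ≤ B a := marg_nonneg hw _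
  have hC0 : ∀ a, 0 ≤ C a := marg_nonneg hw _
  have hD0 : ∀ a, 0 ≤ D a := marg_nonneg hw _
  let R : α × β × γ → ℝ := fun q => A (q.1, q.2.2) * B (q.1, q.2.1) / (C q * D q.1)
  have hR : ∑ ω, w ω * R (x ω, y ω, s ω) ≤ 1 := by
    rw [← sum_marg_mul w (fun ω => (x ω, y ω, s ω)) R]
    calc _ ≤ ∑ q : α × β × γ, A (q.1, q.2.2) * B (q.1, q.2.1) / D q.1 := by
          refine Finset.sum_le_sum fun q _ => ?_
          change C q * R q ≤ _
          have hp : 0 ≤ A (q.1, q.2.2) * B (q.1, q.2.1) / D q.1 :=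
            div_nonneg (mul_nonneg (hA0 _) (hB0 _)) (hD0 _)
          rcases (hC0 q).eq_or_lt with h | h
          · rw [← h, zero_mul]; exact hp
          · apply le_of_eq
            simp only [R]
            rw [div_mul_eq_div_div_swap]
            field_simp
      _ = ∑ a, (∑ c, A (a, c)) * (∑ b, B (a, b)) / D a := by
          rw [Fintype.sum_prod_type]
          refine Finset.sum_congr rfl fun a _ => ?_
          rw [Fintype.sum_prod_type, Finset.sum_comm, Finset.sum_mul_sum, Finset.sum_div]
          refine Finset.sum_congr rfl fun c _ => ?_
          rw [Finset.sum_div]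
      _ = ∑ a, D a * 1 := by
          refine Finset.sum_congr rfl fun a _ => ?_
          rw [hA, hB, marg_pair_sum, marg_pair_sum, mul_self_div_self, mul_one]
      _ = 1 := by rw [hD, sum_marg_mul]; simpa using h1
      _ ≤ 1 := le_rfl
  have hl2 : 0 < Real.log 2 := Real.log_pos (by norm_num)
  have key : ∑ ω, w ω * (1 - R (x ω, y ω, s ω)) / Real.log 2 ≤
      ∑ ω, ((w ω * -Real.logb 2 (A (x ω, s ω)) + w ω * -Real.logb 2 (B (x ω, y ω)))
        - (w ω * -Real.logb 2 (C (x ω, y ω, s ω)) + w ω * -Real.logb 2 (D (x ω)))) := by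
    refine Finset.sum_le_sum fun ω _ => ?_
    rcases (hw ω).eq_or_lt with h0 | h0
    · simp [← h0]
    have a0 : 0 < A (x ω, s ω) := h0.trans_le (le_marg hw (fun ω => (x ω, s ω)) ω)
    have b0 : 0 < B (x ω, y ω) := h0.trans_le (le_marg hw (fun ω => (x ω, y ω)) ω)
    have c0 : 0 < C (x ω, y ω, s ω) := h0.trans_le (le_marg hw (fun ω => (x ω, y ω, s ω)) ω)
    have d0 : 0 < D (x ω) := h0.trans_le (le_marg hw x ω)
    have hlog := Real.log_le_sub_one_of_pos (x := R (x ω, y ω, s ω)) (by simp only [R]; positivity)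
    have e : Real.log (R (x ω, y ω, s ω)) = Real.log (A (x ω, s ω)) + Real.log (B (x ω, y ω))
        - (Real.log (C (x ω, y ω, s ω)) + Real.log (D (x ω))) := by
      simp only [R]
      rw [Real.log_div (by positivity) (by positivity), Real.log_mul a0.ne' b0.ne',
        Real.log_mul c0.ne' d0.ne']
    have e2 : (w ω * -Real.logb 2 (A (x ω, s ω)) + w ω * -Real.logb 2 (B (x ω, y ω)))
        - (w ω * -Real.logb 2 (C (x ω, y ω, s ω)) + w ω * -Real.logb 2 (D (x ω)))
        = w ω * (-Real.log (R (x ω, y ω, s ω))) / Real.log 2 := by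
      rw [e]; simp only [Real.logb]; ring
    rw [e2]
    gcongr
    linarith
  refine le_trans ?_ key
  rw [← Finset.sum_div]
  refine div_nonneg ?_ hl2.le
  simp_rw [mul_sub, mul_one, Finset.sum_sub_distrib]
  linarith

end fin

lemma ent_congr {Ω Ω' α : Type*} [MeasurableSpace Ω] [MeasurableSpace Ω'] [Fintype α]
    [MeasurableSpace α] [MeasurableSingletonClass α] {μ : Measure Ω} {μ' : Measure Ω'}
    {f : Ω → α} {g : Ω' → α} (h : IdentDistrib f g μ μ') : ent μ f = ent μ' g := by
  unfold ent
  refine Finset.sum_congr rfl fun a _ => ?_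
  rw [h.measure_mem_eq (measurableSet_singleton a)]

/-- The sample space with weights. -/
lemma exists_measure {Ω : Type} [Fintype Ω] [MeasurableSpace Ω] [DiscreteMeasurableSpace Ω]
    (w : Ω → ℝ) (hw : ∀ ω, 0 ≤ w ω) (h1 : ∑ ω, w ω = 1) :
    ∃ μ : Measure Ω, IsProbabilityMeasure μ ∧
      ∀ A : Set Ω, (μ A).toReal = ∑ ω, A.indicator w ω := by
  have hs : ∑ ω, ENNReal.ofReal (w ω) = 1 := by
    rw [← ENNReal.ofReal_sum_of_nonneg (fun ω _ => hw ω), h1, ENNReal.ofReal_one]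
  refine ⟨(PMF.ofFintype (fun ω => ENNReal.ofReal (w ω)) hs).toMeasure, inferInstance, ?_⟩
  intro A
  rw [PMF.toMeasure_apply_fintype, ENNReal.toReal_sum]
  · refine Finset.sum_congr rfl fun ω _ => ?_
    by_cases h : ω ∈ A <;> simp [h, hw]
  · intro ω _
    by_cases h : ω ∈ A <;> simp [h]

section constr
variable {𝒮 𝒳 𝒯 : Type} [DecidableEq 𝒮] [Fintype 𝒮] [Fintype 𝒳] [Fintype 𝒯]

open Classical in
/-- Product of the conditional laws away from `s`. -/
noncomputable def KK (q : 𝒮 → 𝒯 → ℝ) (s : 𝒮) (y : 𝒮 → 𝒯) : ℝ :=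
  ∏ s', if s' = s then 1 else q s' (y s')

lemma KK_nonneg {q : 𝒮 → 𝒯 → ℝ} (hq : ∀ s t, 0 ≤ q s t) (s : 𝒮) (y : 𝒮 → 𝒯) : 0 ≤ KK q s y :=
  Finset.prod_nonneg fun s' _ => by split_ifs <;> simp [hq]

lemma mul_KK (q : 𝒮 → 𝒯 → ℝ) (s : 𝒮) (y : 𝒮 → 𝒯) : q s (y s) * KK q s y = ∏ s', q s' (y s') := by
  classical
  unfold KK
  rw [← Finset.mul_prod_erase _ _ (Finset.mem_univ s),
    ← Finset.mul_prod_erase _ (fun s' => q s' (y s')) (Finset.mem_univ s)]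
  simp only [if_true, one_mul]
  congr 1
  refine Finset.prod_congr rfl fun s' h => ?_
  rw [if_neg (Finset.ne_of_mem_erase h)]

open Classical in
lemma sum_KK {q : 𝒮 → 𝒯 → ℝ} (hq1 : ∀ s, ∑ t, q s t = 1) (s : 𝒮) (t : 𝒯) :
    ∑ y : 𝒮 → 𝒯, (if y s = t then KK q s y else 0) = 1 := by
  have h : ∏ s', ∑ t', (if s' = s then (if t' = t then 1 else 0) else q s' t') = (1 : ℝ) := by
    refine Finset.prod_eq_one fun s' _ => ?_
    by_cases hs : s' = s <;> simp [hs, hq1]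
  rw [Finset.prod_univ_sum, Fintype.piFinset_univ] at h
  rw [← h]
  refine Finset.sum_congr rfl fun y _ => ?_
  unfold KK
  split_ifs with hy
  · refine Finset.prod_congr rfl fun s' _ => ?_
    by_cases hs : s' = s
    · subst hs; simp [hy]
    · simp [hs]
  · symm
    exact Finset.prod_eq_zero (Finset.mem_univ s) (by simp [hy])

/-- The weights. -/
noncomputable def wt (p : 𝒮 → 𝒳 → 𝒯 → ℝ) (q : 𝒮 → 𝒯 → ℝ) (α : ℝ)
    (ω : 𝒮 × 𝒳 × (𝒮 → 𝒯) × Bool) : ℝ :=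
  p ω.1 ω.2.1 (ω.2.2.1 ω.1) * KK q ω.1 ω.2.2.1 * (if ω.2.2.2 then α else 1 - α)

/-- The representation. -/
def YY (ω : 𝒮 × 𝒳 × (𝒮 → 𝒯) × Bool) : (𝒮 → 𝒯) × Option 𝒮 :=
  (ω.2.2.1, if ω.2.2.2 then some ω.1 else none)

lemma exists_q [Nonempty 𝒯] (p : 𝒮 → 𝒯 → ℝ) (hp : ∀ s t, 0 ≤ p s t) :
    ∃ q : 𝒮 → 𝒯 → ℝ, (∀ s t, 0 ≤ q s t) ∧ (∀ s, ∑ t, q s t = 1) ∧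
      ∀ s t, p s t = (∑ t', p s t') * q s t := by
  classical
  obtain ⟨t0⟩ := ‹Nonempty 𝒯›
  refine ⟨fun s t => if ∑ t', p s t' = 0 then (if t = t0 then 1 else 0)
    else p s t / ∑ t', p s t', ?_, ?_, ?_⟩
  · intro s t
    have := Finset.sum_nonneg (fun t' (_ : t' ∈ Finset.univ) => hp s t')
    dsimp only
    split_ifs
    · exact zero_le_one
    · exact le_rfl
    · exact div_nonneg (hp s t) this
  · intro s
    by_cases h : ∑ t', p s t' = 0
    · simp [h]
    · simp only [h, if_false]
      rw [← Finset.sum_div, div_self h]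
  · intro s t
    by_cases h : ∑ t', p s t' = 0
    · have := (Finset.sum_eq_zero_iff_of_nonneg (fun t' _ => hp s t')).1 h t (Finset.mem_univ t)
      simp [h, this]
    · simp only [h, if_false]
      field_simp

lemma marg_SXT (p : 𝒮 → 𝒳 → 𝒯 → ℝ) {q : 𝒮 → 𝒯 → ℝ} (hq1 : ∀ s, ∑ t, q s t = 1) (α : ℝ)
    (s : 𝒮) (x : 𝒳) (t : 𝒯) :
    marg (wt p q α) (fun ω => (ω.1, ω.2.1, ω.2.2.1 ω.1)) (s, x, t) = p s x t := by
  classical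
  have h := sum_KK hq1 s t
  unfold marg wt
  rw [Fintype.sum_prod_type, Finset.sum_eq_single s _ (by simp)]
  · rw [Fintype.sum_prod_type, Finset.sum_eq_single x _ (by simp)]
    · rw [Fintype.sum_prod_type]
      have e : ∑ y : 𝒮 → 𝒯, p s x t * (if y s = t then KK q s y else 0) = p s x t := by
        rw [← Finset.mul_sum, h, mul_one]
      refine Eq.trans ?_ e
      refine Finset.sum_congr rfl fun y _ => ?_
      by_cases hy : y s = t
      · simp [hy]; ring
      · simp [hy]
    · intro x' _ hx
      simp [hx]
  · intro s' _ hs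
    simp [hs]

lemma marg_S (p : 𝒮 → 𝒳 → 𝒯 → ℝ) {q : 𝒮 → 𝒯 → ℝ} (hq1 : ∀ s, ∑ t, q s t = 1) (α : ℝ)
    (s : 𝒮) :
    marg (wt p q α) (fun ω => ω.1) s = ∑ t, ∑ x, p s x t := by
  rw [← marg_pair_sum (wt p q α) (fun ω => ω.1) (fun ω => (ω.2.1, ω.2.2.1 ω.1)) s,
    Fintype.sum_prod_type, Finset.sum_comm]
  simp_rw [marg_SXT p hq1 α]

lemma marg_YS (p : 𝒮 → 𝒳 → 𝒯 → ℝ) {q : 𝒮 → 𝒯 → ℝ}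
    (hq : ∀ s t, ∑ x, p s x t = (∑ t', ∑ x, p s x t') * q s t) (α : ℝ)
    (s : 𝒮) (y : 𝒮 → 𝒯) :
    marg (wt p q α) (fun ω => (YY ω, ω.1)) ((y, none), s) =
      (∑ t', ∑ x, p s x t') * ((1 - α) * ∏ s', q s' (y s')) := by
  classical
  unfold marg wt YY
  rw [Fintype.sum_prod_type, Finset.sum_eq_single s _ (by simp)]
  · have : (∑ t', ∑ x, p s x t') * ((1 - α) * ∏ s', q s' (y s')) =
        ∑ x, p s x (y s) * KK q s y * (1 - α) := by
      rw [← mul_KK q s y, ← Finset.sum_mul, ← Finset.sum_mul, hq]; ring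
    rw [this, Fintype.sum_prod_type]
    refine Finset.sum_congr rfl fun x _ => ?_
    rw [Fintype.sum_prod_type, Finset.sum_eq_single y _ (by simp)]
    · simp
    · intro y' _ hy
      simp [hy]
  · intro s' _ hs
    simp [hs]

lemma marg_Y (p : 𝒮 → 𝒳 → 𝒯 → ℝ) {q : 𝒮 → 𝒯 → ℝ}
    (hq : ∀ s t, ∑ x, p s x t = (∑ t', ∑ x, p s x t') * q s t)
    (hp1 : ∑ s, ∑ t, ∑ x, p s x t = 1) (α : ℝ) (y : 𝒮 → 𝒯) :
    marg (wt p q α) YY (y, none) = (1 - α) * ∏ s', q s' (y s') := by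
  rw [← marg_pair_sum (wt p q α) YY (fun ω => ω.1)]
  simp_rw [marg_YS p hq α]
  rw [← Finset.sum_mul, hp1, one_mul]

lemma sum_bool_part (p : 𝒮 → 𝒳 → 𝒯 → ℝ) (q : 𝒮 → 𝒯 → ℝ) (α : ℝ) (F : 𝒮 → ℝ) :
    ∑ ω, wt p q α ω * (if ω.2.2.2 then F ω.1 else 0) = α * ∑ ω, wt p q α ω * F ω.1 := by
  unfold wt
  rw [Finset.mul_sum]
  simp only [Fintype.sum_prod_type, Fintype.sum_bool]
  refine Finset.sum_congr rfl fun s _ => ?_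
  refine Finset.sum_congr rfl fun x _ => ?_
  refine Finset.sum_congr rfl fun y _ => ?_
  simp
  ring

lemma mutInf_YS [MeasurableSpace (𝒮 × 𝒳 × (𝒮 → 𝒯) × Bool)]
    (μ : Measure (𝒮 × 𝒳 × (𝒮 → 𝒯) × Bool))
    (p : 𝒮 → 𝒳 → 𝒯 → ℝ) {q : 𝒮 → 𝒯 → ℝ} (α : ℝ)
    (hw : ∀ ω, 0 ≤ wt p q α ω)
    (hμ : ∀ A : Set (𝒮 × 𝒳 × (𝒮 → 𝒯) × Bool), (μ A).toReal = ∑ ω, A.indicator (wt p q α) ω)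
    (hq1 : ∀ s, ∑ t, q s t = 1)
    (hq : ∀ s t, ∑ x, p s x t = (∑ t', ∑ x, p s x t') * q s t)
    (hp1 : ∑ s, ∑ t, ∑ x, p s x t = 1) :
    mutInf μ YY (fun ω => ω.1) = α * ent μ (fun ω : 𝒮 × 𝒳 × (𝒮 → 𝒯) × Bool => ω.1) := by
  unfold mutInf
  simp_rw [ent_eq_s16 μ _ hμ]
  rw [← sum_bool_part p q α (fun s => -Real.logb 2 (marg (wt p q α) (fun ω => ω.1) s)),
    ← Finset.sum_add_distrib, ← Finset.sum_sub_distrib]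
  refine Finset.sum_congr rfl fun ω _ => ?_
  rcases (hw ω).eq_or_lt with h0 | h0
  · simp [← h0]
  have hS0 := h0.trans_le (le_marg hw (fun ω => ω.1) ω)
  have hY0 := h0.trans_le (le_marg hw YY ω)
  obtain ⟨s, x, y, b⟩ := ω
  cases b
  · have e1 : YY (s, x, y, false) = (y, none) := by simp [YY]
    rw [e1] at hY0 ⊢
    rw [marg_Y p hq hp1] at hY0
    dsimp only at hS0 ⊢
    rw [marg_S p hq1] at hS0
    rw [marg_YS p hq, marg_S p hq1, marg_Y p hq hp1, Real.logb_mul hS0.ne' hY0.ne']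
    simp
    ring
  · have e : marg (wt p q α) (fun ω => (YY ω, ω.1)) (YY (s, x, y, true), s) =
        marg (wt p q α) YY (YY (s, x, y, true)) := by
      refine marg_congr _ _ _ _ _ fun ω => ?_
      obtain ⟨s', x', y', b'⟩ := ω
      cases b' <;> simp [YY]
    dsimp only
    rw [e]
    simp

end constr


/-- **Lower bound `L′₁^{r,ε}` of Theorem 2 (high-rate regime).** For `0 ≤ ε < min{I(S;X), H(S)}` and `H(X|S) + ε ≤ r < H(X)` there is a representation `Y` with `I(Y;S') ≤ ε`, `I(X';Y) ≤ r`, and `I(Y;T') ≥ H(T|S) − H(S|T) + ε`. -/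
theorem lower_bound_L1re_prime
    {Ω 𝒮 𝒳 𝒯 : Type} [MeasurableSpace Ω] (μ : Measure Ω) [IsProbabilityMeasure μ]
    [Fintype 𝒮] [MeasurableSpace 𝒮] [MeasurableSingletonClass 𝒮]
    [Fintype 𝒳] [MeasurableSpace 𝒳] [MeasurableSingletonClass 𝒳]
    [Fintype 𝒯] [MeasurableSpace 𝒯] [MeasurableSingletonClass 𝒯]
    (S : Ω → 𝒮) (X : Ω → 𝒳) (T : Ω → 𝒯)
    (hS : Measurable S) (hX : Measurable X) (hT : Measurable T)
    (ε : ℝ) (hε0 : 0 ≤ ε) (hε1 : ε < min (mutInf μ S X) (ent μ S))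
    (r : ℝ) (hr0 : condEnt μ X S + ε ≤ r) (hr1 : r < ent μ X) :
    ∃ (Ω' : Type) (_ : MeasurableSpace Ω') (μ' : Measure Ω')
      (𝒴 : Type) (_ : Fintype 𝒴) (_ : MeasurableSpace 𝒴)
      (S' : Ω' → 𝒮) (X' : Ω' → 𝒳) (T' : Ω' → 𝒯) (Y : Ω' → 𝒴),
      IsProbabilityMeasure μ' ∧
      Measurable S' ∧ Measurable X' ∧ Measurable T' ∧ Measurable Y ∧
      IdentDistrib (fun ω => (S ω, X ω, T ω)) (fun ω => (S' ω, X' ω, T' ω)) μ μ' ∧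
      mutInf μ' Y S' ≤ ε ∧ mutInf μ' X' Y ≤ r ∧
      mutInf μ' Y T' ≥ condEnt μ T S - condEnt μ S T + ε := by
  classical
  have hΩ : Nonempty Ω := nonempty_of_isProbabilityMeasure μ
  have h𝒯 : Nonempty 𝒯 := hΩ.map T
  have hV : Measurable (fun ω => (S ω, X ω, T ω)) := hS.prodMk (hX.prodMk hT)
  let V : Ω → 𝒮 × 𝒳 × 𝒯 := fun ω => (S ω, X ω, T ω)
  let p : 𝒮 → 𝒳 → 𝒯 → ℝ := fun s x t => (μ (V ⁻¹' {(s, x, t)})).toReal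
  have hp0 : ∀ s x t, 0 ≤ p s x t := fun s x t => ENNReal.toReal_nonneg
  have hp1' : ∑ v : 𝒮 × 𝒳 × 𝒯, p v.1 v.2.1 v.2.2 = 1 := by
    have h : ∑ v : 𝒮 × 𝒳 × 𝒯, μ (V ⁻¹' {v}) = 1 := by
      rw [sum_measure_preimage_singleton _ (fun v _ => hV (measurableSet_singleton v))]
      simp
    have h2 := congrArg ENNReal.toReal h
    rw [ENNReal.toReal_sum (fun v _ => measure_ne_top _ _)] at h2
    simpa using h2
  have hp1 : ∑ s, ∑ t, ∑ x, p s x t = 1 := by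
    rw [← hp1', Fintype.sum_prod_type]
    refine Finset.sum_congr rfl fun s _ => ?_
    rw [Fintype.sum_prod_type, Finset.sum_comm]
  obtain ⟨q, hq0, hq1, hq⟩ := exists_q (fun s t => ∑ x, p s x t)
    (fun s t => Finset.sum_nonneg fun x _ => hp0 s x t)
  have hεS : ε < ent μ S := hε1.trans_le (min_le_right _ _)
  have hH0 : 0 < ent μ S := hε0.trans_lt hεS
  let α : ℝ := ε / ent μ S
  have hα0 : 0 ≤ α := div_nonneg hε0 hH0.le
  have hα1 : α ≤ 1 := (div_le_one hH0).2 hεS.le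
  have hw : ∀ ω, 0 ≤ wt p q α ω := by
    intro ω
    unfold wt
    refine mul_nonneg (mul_nonneg (hp0 _ _ _) (KK_nonneg hq0 _ _)) ?_
    split_ifs <;> linarith
  have hw1 : ∑ ω, wt p q α ω = 1 := by
    have := sum_marg_mul (wt p q α) (fun ω => (ω.1, ω.2.1, ω.2.2.1 ω.1)) (fun _ => 1)
    simp only [mul_one] at this
    rw [← this, ← hp1']
    exact Finset.sum_congr rfl fun v _ => marg_SXT p hq1 α v.1 v.2.1 v.2.2
  let mΩ : MeasurableSpace (𝒮 × 𝒳 × (𝒮 → 𝒯) × Bool) := ⊤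
  have : DiscreteMeasurableSpace (𝒮 × 𝒳 × (𝒮 → 𝒯) × Bool) := ⟨fun _ => trivial⟩
  obtain ⟨μ', hμp, hμ⟩ := exists_measure (wt p q α) hw hw1
  have hid : IdentDistrib (fun ω => (S ω, X ω, T ω))
      (fun ω : 𝒮 × 𝒳 × (𝒮 → 𝒯) × Bool => (ω.1, ω.2.1, ω.2.2.1 ω.1)) μ μ' := by
    refine ⟨hV.aemeasurable, Measurable.of_discrete.aemeasurable, ?_⟩
    refine Measure.ext_of_singleton fun v => ?_
    rw [Measure.map_apply hV (measurableSet_singleton v),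
      Measure.map_apply Measurable.of_discrete (measurableSet_singleton v)]
    rw [← ENNReal.toReal_eq_toReal_iff' (measure_ne_top _ _) (measure_ne_top _ _), hμ]
    refine (marg_SXT p hq1 α v.1 v.2.1 v.2.2).symm.trans ?_
    unfold marg
    refine Finset.sum_congr rfl fun ω _ => ?_
    simp [Set.indicator]
  have eS : ent μ S = ent μ' (fun ω => ω.1) :=
    ent_congr (hid.comp (u := fun v : 𝒮 × 𝒳 × 𝒯 => v.1) Measurable.of_discrete)
  have eT : ent μ T = ent μ' (fun ω => ω.2.2.1 ω.1) :=
    ent_congr (hid.comp (u := fun v : 𝒮 × 𝒳 × 𝒯 => v.2.2) Measurable.of_discrete)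
  have eXS : ent μ (fun ω => (X ω, S ω)) = ent μ' (fun ω => (ω.2.1, ω.1)) :=
    ent_congr (hid.comp (u := fun v => (v.2.1, v.1)) Measurable.of_discrete)
  have eTS : ent μ (fun ω => (T ω, S ω)) = ent μ' (fun ω => (ω.2.2.1 ω.1, ω.1)) :=
    ent_congr (hid.comp (u := fun v => (v.2.2, v.1)) Measurable.of_discrete)
  have eST : ent μ (fun ω => (S ω, T ω)) = ent μ' (fun ω => (ω.1, ω.2.2.1 ω.1)) :=
    ent_congr (hid.comp (u := fun v => (v.1, v.2.2)) Measurable.of_discrete)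
  have hI : mutInf μ' YY (fun ω => ω.1) = ε := by
    rw [mutInf_YS μ' p α hw hμ hq1 hq hp1, ← eS]
    exact div_mul_cancel₀ _ hH0.ne'
  refine ⟨𝒮 × 𝒳 × (𝒮 → 𝒯) × Bool, mΩ, μ', (𝒮 → 𝒯) × Option 𝒮, inferInstance, ⊤,
    fun ω => ω.1, fun ω => ω.2.1, fun ω => ω.2.2.1 ω.1, YY, hμp,
    Measurable.of_discrete, Measurable.of_discrete, Measurable.of_discrete,
    fun _ _ => trivial, hid, hI.le, ?_, ?_⟩
  · refine le_trans ?_ hr0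
    rw [← hI]
    unfold mutInf condEnt
    rw [eS, eXS]
    have h1 := ent_submod_s16 μ' _ hw hw1 hμ (fun ω => ω.2.1) YY (fun ω => ω.1)
    have h2 := ent_mono μ' _ hw hμ (fun ω => (ω.2.1, YY ω, ω.1)) (fun ω => (YY ω, ω.1))
      (by intro ω ω' h; exact congrArg Prod.snd h)
    linarith
  · rw [← hI]
    unfold mutInf condEnt
    rw [eS, eT, eTS, eST]
    have h1 := ent_mono μ' _ hw hμ (fun ω => (ω.2.2.1 ω.1, ω.1)) (fun ω => (ω.1, ω.2.2.1 ω.1))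
      (by intro ω ω' h; simp only [Prod.mk.injEq] at h ⊢; exact h.symm)
    have h1' := ent_mono μ' _ hw hμ (fun ω => (ω.1, ω.2.2.1 ω.1)) (fun ω => (ω.2.2.1 ω.1, ω.1))
      (by intro ω ω' h; simp only [Prod.mk.injEq] at h ⊢; exact h.symm)
    have h2 := ent_mono μ' _ hw hμ (fun ω => (YY ω, ω.1)) (fun ω => (YY ω, ω.2.2.1 ω.1))
      (by
        intro ω ω' h
        simp only [Prod.mk.injEq] at h ⊢
        refine ⟨h.1, ?_⟩
        have h3 : (YY ω).1 = (YY ω').1 := congrArg Prod.fst h.1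
        change ω.2.2.1 = ω'.2.2.1 at h3
        rw [h3, h.2])
    linarith
end
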